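/- Geometric convergence of the iterated optimal stopping approximation: assume (H.1), (H.2), (H.3) and (H.4). Let u be the bounded viscosity solution of the HJBQVI system and let (u^n)_{n≥0} be the iterated optimal stopping iterates. Then there exist constants μ ∈ (0,1] and C ≥ 0 such that 0 ≤ u^n_i(x) − u_i(x) ≤ C(1−μ)^n for all x ∈ ℝ^d, i ∈ ℐ and n ≥ 0; in particular, the iterates (u^n)_{n≥0} are bounded uniformly in n. -/

import Mathlib

noncomputable section
open scoped BigOperators RealInnerProductSpace
open Filter Topology Matrix

namespace HJBQVI

abbrev E (d : ℕ) : Type := EuclideanSpace ℝ (Fin d)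

variable {d d' M : ℕ}

/-- Frobenius norm of a matrix. -/
def frobNorm (A : Matrix (Fin d) (Fin d') ℝ) : ℝ :=
  Real.sqrt (∑ k, ∑ l, (A k l) ^ 2)

/-- Hessian matrix of a real-valued function, via the second iterated Fréchet derivative. -/
def hess (φ : E d → ℝ) (x : E d) : Matrix (Fin d) (Fin d) ℝ :=
  Matrix.of fun i j =>
    iteratedFDeriv ℝ 2 φ x ![EuclideanSpace.single i (1 : ℝ), EuclideanSpace.single j (1 : ℝ)]

/-- Semiconcavity with constant `C`. -/
def Semiconcave (φ : E d → ℝ) (C : ℝ) : Prop :=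
  ∀ x h : E d, φ (x + h) - 2 * φ x + φ (x - h) ≤ C * ‖h‖ ^ 2

/-- Membership in `C⁰₁(ℝ^d)`: bounded, continuous, Lipschitz. -/
def InC01 (f : E d → ℝ) : Prop :=
  Continuous f ∧ (∃ C, ∀ x, |f x| ≤ C) ∧ ∃ L, ∀ x y, |f x - f y| ≤ L * ‖x - y‖

/-- Uniform boundedness of a system of functions. -/
def Bdd (u : Fin M → E d → ℝ) : Prop := ∃ C, ∀ i x, |u i x| ≤ C

/-- Coefficient data for the weakly coupled HJB operator. -/
structure HJBData (d d' M : ℕ) (𝒜 : Type) [MetricSpace 𝒜] where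
  A : Fin M → Set 𝒜
  σm : Fin M → 𝒜 → E d → Matrix (Fin d) (Fin d') ℝ
  bv : Fin M → 𝒜 → E d → E d
  cz : Fin M → 𝒜 → E d → ℝ
  runCost : Fin M → 𝒜 → E d → ℝ
  dcp : Fin M → Fin M → 𝒜 → E d → ℝ

variable {𝒜 𝒵 : Type} [MetricSpace 𝒜] [MetricSpace 𝒵]

/-- The linear operator `L^α_i(x, s, p, X)`. -/
def HJBData.L (P : HJBData d d' M 𝒜) (i : Fin M) (α : 𝒜) (x : E d)
    (s : Fin M → ℝ) (p : E d) (X : Matrix (Fin d) (Fin d) ℝ) : ℝ :=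
  - Matrix.trace (((1 : ℝ) / 2) • (P.σm i α x * (P.σm i α x)ᵀ) * X)
  - ⟪P.bv i α x, p⟫ + P.cz i α x * s i - P.runCost i α x
  - ∑ j ∈ Finset.univ.erase i, P.dcp i j α x * s j

/-- The Hamiltonian `sup_{α ∈ A_i} L^α_i`. -/
def HJBData.Ham (P : HJBData d d' M 𝒜) (i : Fin M) (x : E d)
    (s : Fin M → ℝ) (p : E d) (X : Matrix (Fin d) (Fin d) ℝ) : ℝ :=
  sSup ((fun α => P.L i α x s p X) '' P.A i)

/-- Data of the impulse intervention operator. -/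
structure ImpulseData (d M : ℕ) (𝒵 : Type) [MetricSpace 𝒵] where
  Z : Fin M → E d → Set 𝒵
  Γ : Fin M → E d → 𝒵 → E d
  K : Fin M → E d → 𝒵 → ℝ

/-- The intervention operator `(M_i u)(x) = min_{z ∈ Z_i(x)} [u_i(Γ_i(x,z)) + K_i(x,z)]`. -/
def ImpulseData.Mop (Q : ImpulseData d M 𝒵) (i : Fin M) (u : Fin M → E d → ℝ) (x : E d) : ℝ :=
  sInf ((fun z => u i (Q.Γ i x z) + Q.K i x z) '' Q.Z i x)

/-- Type of (possibly nonlocal) degenerate elliptic operators. -/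
abbrev Op (d M : ℕ) : Type :=
  Fin M → E d → (Fin M → E d → ℝ) → E d → Matrix (Fin d) (Fin d) ℝ → ℝ

/-- Viscosity subsolution (upper semicontinuous, tested from above by C² functions). -/
def IsSubsolution (F : Op d M) (u : Fin M → E d → ℝ) : Prop :=
  (∀ i, UpperSemicontinuous (u i)) ∧
  ∀ (i : Fin M) (φ : E d → ℝ), ContDiff ℝ 2 φ → ∀ x : E d,
    IsLocalMax (fun y => u i y - φ y) x → F i x u (gradient φ x) (hess φ x) ≤ 0

/-- Viscosity supersolution. -/
def IsSupersolution (F : Op d M) (u : Fin M → E d → ℝ) : Prop :=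
  (∀ i, LowerSemicontinuous (u i)) ∧
  ∀ (i : Fin M) (φ : E d → ℝ), ContDiff ℝ 2 φ → ∀ x : E d,
    IsLocalMin (fun y => u i y - φ y) x → 0 ≤ F i x u (gradient φ x) (hess φ x)

/-- Viscosity solution: continuous and both a sub- and a supersolution. -/
def IsSolution (F : Op d M) (u : Fin M → E d → ℝ) : Prop :=
  (∀ i, Continuous (u i)) ∧ IsSubsolution F u ∧ IsSupersolution F u

/-- Pure HJB operator. -/
def Fhjb (P : HJBData d d' M 𝒜) : Op d M :=
  fun i x u p X => P.Ham i x (fun j => u j x) p X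

/-- Obstacle problem operator with obstacle `Ψ`. -/
def Fob (P : HJBData d d' M 𝒜) (Ψ : Fin M → E d → ℝ) : Op d M :=
  fun i x u p X => max (P.Ham i x (fun j => u j x) p X) (u i x - Ψ i x)

/-- Penalized obstacle problem operator. -/
def FobPen (P : HJBData d d' M 𝒜) (Ψ : Fin M → E d → ℝ) (ρ : ℝ) : Op d M :=
  fun i x u p X => P.Ham i x (fun j => u j x) p X + ρ * max (u i x - Ψ i x) 0

/-- The HJBQVI operator. -/
def Fqvi (P : HJBData d d' M 𝒜) (Q : ImpulseData d M 𝒵) : Op d M :=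
  fun i x u p X => max (P.Ham i x (fun j => u j x) p X) (u i x - Q.Mop i u x)

/-- The penalized HJBQVI operator with penalty parameter `ρ`. -/
def Fpen (P : HJBData d d' M 𝒜) (Q : ImpulseData d M 𝒵) (ρ : ℝ) : Op d M :=
  fun i x u p X => P.Ham i x (fun j => u j x) p X + ρ * max (u i x - Q.Mop i u x) 0

/-- Assumption (H.1). -/
def H1 (P : HJBData d d' M 𝒜) (C lam0 : ℝ) : Prop :=
  0 < lam0 ∧
  (∀ i, (P.A i).Nonempty ∧ IsCompact (P.A i)) ∧
  ∀ i, ∀ α ∈ P.A i,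
    (∀ k l, Continuous fun x => P.σm i α x k l) ∧
    Continuous (P.bv i α) ∧ Continuous (P.cz i α) ∧ Continuous (P.runCost i α) ∧
    (∀ j, Continuous (P.dcp i j α)) ∧
    (∀ x, frobNorm (P.σm i α x) ≤ C) ∧
    (∀ x y, frobNorm (P.σm i α x - P.σm i α y) ≤ C * ‖x - y‖) ∧
    (∀ x, ‖P.bv i α x‖ ≤ C) ∧ (∀ x y, ‖P.bv i α x - P.bv i α y‖ ≤ C * ‖x - y‖) ∧
    (∀ x, |P.cz i α x| ≤ C) ∧ (∀ x y, |P.cz i α x - P.cz i α y| ≤ C * ‖x - y‖) ∧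
    (∀ x, |P.runCost i α x| ≤ C) ∧
    (∀ x y, |P.runCost i α x - P.runCost i α y| ≤ C * ‖x - y‖) ∧
    (∀ j, (∀ x, |P.dcp i j α x| ≤ C) ∧ ∀ x y, |P.dcp i j α x - P.dcp i j α y| ≤ C * ‖x - y‖) ∧
    (∀ j ∈ Finset.univ.erase i, ∀ x, 0 ≤ P.dcp i j α x) ∧
    ∀ x, lam0 ≤ P.cz i α x - ∑ j ∈ Finset.univ.erase i, P.dcp i j α x

/-- Assumption (H.2). -/
def H2 (Q : ImpulseData d M 𝒵) (κ₀ : ℝ) : Prop :=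
  0 < κ₀ ∧
  (∀ i x, (Q.Z i x).Nonempty ∧ IsCompact (Q.Z i x)) ∧
  (∀ i, Continuous fun p : E d × 𝒵 => Q.Γ i p.1 p.2) ∧
  (∀ i, Continuous fun p : E d × 𝒵 => Q.K i p.1 p.2) ∧
  (∀ (i : Fin M) (x : E d), ∀ ε > (0 : ℝ), ∃ δ > (0 : ℝ), ∀ y, dist y x < δ →
      Metric.hausdorffDist (Q.Z i x) (Q.Z i y) < ε) ∧
  ∀ i x, ∀ z ∈ Q.Z i x, κ₀ ≤ Q.K i x z

/-- Assumption (H.3): `λ₀ > sup_{i,α} ([σ^α_i]₁² + [b^α_i]₁)`. -/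
def H3 (P : HJBData d d' M 𝒜) (lam0 : ℝ) : Prop :=
  ∃ Kσ Kb : ℝ, 0 ≤ Kσ ∧ 0 ≤ Kb ∧ Kσ ^ 2 + Kb < lam0 ∧
    ∀ i, ∀ α ∈ P.A i,
      (∀ x y, frobNorm (P.σm i α x - P.σm i α y) ≤ Kσ * ‖x - y‖) ∧
      ∀ x y, ‖P.bv i α x - P.bv i α y‖ ≤ Kb * ‖x - y‖

/-- Assumption (H.4): the intervention operator preserves Lipschitz functions,
`[M_i u]₁ ≤ sup_j [u_j]₁ + C`. -/
def H4 (Q : ImpulseData d M 𝒵) (C : ℝ) : Prop :=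
  0 ≤ C ∧ ∀ u : Fin M → E d → ℝ, (∀ i, InC01 (u i)) →
    ∀ L : ℝ, 0 ≤ L → (∀ i x y, |u i x - u i y| ≤ L * ‖x - y‖) →
      ∀ i x y, |Q.Mop i u x - Q.Mop i u y| ≤ (L + C) * ‖x - y‖

/-- `C¹` regularity with bounded and Lipschitz derivative. -/
def C1Bound {F : Type} [NormedAddCommGroup F] [NormedSpace ℝ F] (f : E d → F) (C : ℝ) : Prop :=
  ContDiff ℝ 1 f ∧ (∀ x, ‖fderiv ℝ f x‖ ≤ C) ∧
    ∀ x y, ‖fderiv ℝ f x - fderiv ℝ f y‖ ≤ C * ‖x - y‖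

/-- Assumption (H.5). -/
def H5 (P : HJBData d d' M 𝒜) (C : ℝ) : Prop :=
  ∀ i, ∀ α ∈ P.A i,
    (∀ k l, C1Bound (fun x => P.σm i α x k l) C) ∧
    C1Bound (P.bv i α) C ∧ C1Bound (P.cz i α) C ∧
    (∀ j, C1Bound (P.dcp i j α) C) ∧
    Semiconcave (P.runCost i α) C

/-- Assumption (H.6): the intervention operator preserves semiconcave functions,
`[M_i u]_{2,+} ≤ sup_j [u_j]_{2,+} + C`. -/
def H6 (Q : ImpulseData d M 𝒵) (C : ℝ) : Prop :=
  0 ≤ C ∧ ∀ u : Fin M → E d → ℝ, (∀ i, Continuous (u i)) → (∃ B, ∀ i x, |u i x| ≤ B) →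
    ∀ Cu : ℝ, 0 ≤ Cu → (∀ i, Semiconcave (u i) Cu) →
      ∀ i, Semiconcave (fun x => Q.Mop i u x) (Cu + C)

/-- Switching intervention operator `(M_i u)(x) = min_{j ≠ i} [u_j(x) + k_{ij}(x)]`. -/
def Msw (k : Fin M → Fin M → E d → ℝ) (i : Fin M) (u : Fin M → E d → ℝ) (x : E d) : ℝ :=
  sInf ((fun j => u j x + k i j x) '' {j | j ≠ i})

/-- The switching HJBQVI operator. -/
def Fsw (P : HJBData d d' M 𝒜) (k : Fin M → Fin M → E d → ℝ) : Op d M :=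
  fun i x u p X => max (P.Ham i x (fun j => u j x) p X) (u i x - Msw k i u x)

/-- The componentwise penalized switching system operator. -/
def FswPen (P : HJBData d d' M 𝒜) (k : Fin M → Fin M → E d → ℝ) (ρ : ℝ) : Op d M :=
  fun i x u p X => P.Ham i x (fun j => u j x) p X
    + ρ * ∑ j ∈ Finset.univ.erase i, max (u i x - u j x - k i j x) 0

/-- Assumption (H.7) on signed switching costs. -/
def H7 (k : Fin M → Fin M → E d → ℝ) (κ₀ C : ℝ) : Prop :=
  0 < κ₀ ∧ 0 ≤ C ∧
  (∀ i x, k i i x = 0) ∧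
  (∀ i j l, j ≠ i → ∀ x : E d, κ₀ ≤ k i j x + k j l x - k i l x) ∧
  (∀ i j, (∀ x, |k i j x| ≤ C) ∧ ∀ x y, |k i j x - k i j y| ≤ C * ‖x - y‖) ∧
  ∀ i j (x : E d), k i j x < κ₀ → ∃ h₀ > (0 : ℝ), ∀ h : E d, ‖h‖ < h₀ →
    k i j (x + h) - 2 * k i j x + k i j (x - h) ≤ C * ‖h‖ ^ 2

/-- `k̃_i = min{min_{j≠i}(k_{ji} − ε), 0}`. -/
def ktil (k : Fin M → Fin M → E d → ℝ) (ε : ℝ) (i : Fin M) (x : E d) : ℝ :=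
  sInf (insert 0 ((fun j => k j i x - ε) '' {j | j ≠ i}))

/-- Strict viscosity subsolution with margin `g`: `F_i(x, u, Dφ, D²φ) ≤ g` at
every local maximum of `u_i − φ`. -/
def IsStrictSubsolution (F : Op d M) (g : ℝ) (u : Fin M → E d → ℝ) : Prop :=
  (∀ i, UpperSemicontinuous (u i)) ∧
  ∀ (i : Fin M) (φ : E d → ℝ), ContDiff ℝ 2 φ → ∀ x : E d,
    IsLocalMax (fun y => u i y - φ y) x → F i x u (gradient φ x) (hess φ x) ≤ g

/-- Half-relaxed upper limit `u*(x) = limsup_{ρ→∞, y→x} u^ρ(y)`. -/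
def relaxSup (u : ℕ → E d → ℝ) (x : E d) : ℝ :=
  Filter.limsup (fun p : ℕ × E d => u p.1 p.2) (Filter.atTop ×ˢ nhds x)

/-- Half-relaxed lower limit `u_*(x) = liminf_{ρ→∞, y→x} u^ρ(y)`. -/
def relaxInf (u : ℕ → E d → ℝ) (x : E d) : ℝ :=
  Filter.liminf (fun p : ℕ × E d => u p.1 p.2) (Filter.atTop ×ˢ nhds x)

/-- Set of optimal impulse controls `𝒵^v_i(x)`. -/
def argminSet (Q : ImpulseData d M 𝒵) (v : Fin M → E d → ℝ) (i : Fin M) (x : E d) : Set 𝒵 :=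
  {z | z ∈ Q.Z i x ∧ ∀ z' ∈ Q.Z i x,
    v i (Q.Γ i x z) + Q.K i x z ≤ v i (Q.Γ i x z') + Q.K i x z'}

section SemiconvexFunctions

variable {H : Type*} [NormedAddCommGroup H] [InnerProductSpace ℝ H]

/-- `w` is semiconvex with constant `K`: it is touched from below at every point by a paraboloid
of opening `-K`. -/
def IsSemiconvexWith (K : ℝ) (w : H → ℝ) : Prop :=
  ∀ z, ∃ p : H, ∀ y, w z + ⟪p, y - z⟫ - K / 2 * ‖y - z‖ ^ 2 ≤ w y

/-- `w` is touched from above at `z` by the affine function of slope `p`. -/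
def IsContact (w : H → ℝ) (z p : H) : Prop := ∀ y, w y ≤ w z + ⟪p, y - z⟫

lemma IsContact.lower_bound {K : ℝ} {w : H → ℝ} (hw : IsSemiconvexWith K w) {z p : H}
    (hz : IsContact w z p) (y : H) : w z + ⟪p, y - z⟫ - K / 2 * ‖y - z‖ ^ 2 ≤ w y := by
  obtain ⟨q, hq⟩ := hw z
  suffices h : q = p by rw [← h]; exact hq y
  by_contra hne
  have hpos : 0 < ‖q - p‖ ^ 2 := by
    have := norm_pos_iff.2 (sub_ne_zero.2 hne)
    positivity
  set t : ℝ := 1 / (|K| + 1)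
  have ht : 0 < t := by positivity
  have h1 := (hq (z + t • (q - p))).trans (hz (z + t • (q - p)))
  have h2 : ⟪q, t • (q - p)⟫ - ⟪p, t • (q - p)⟫ = t * ‖q - p‖ ^ 2 := by
    rw [← inner_sub_left, inner_smul_right, real_inner_self_eq_norm_sq]
  simp only [add_sub_cancel_left, norm_smul, Real.norm_eq_abs, abs_of_pos ht, mul_pow] at h1
  have h3 : K * t ≤ 1 := by
    simp only [t, mul_one_div]
    rw [div_le_one (by positivity)]
    linarith [le_abs_self K]
  nlinarith [mul_pos ht hpos, mul_le_mul_of_nonneg_right h3 (mul_pos ht hpos).le]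

lemma IsContact.dist_le {K : ℝ} {w : H → ℝ} (hw : IsSemiconvexWith K w) {z₁ z₂ p₁ p₂ : H}
    (h₁ : IsContact w z₁ p₁) (h₂ : IsContact w z₂ p₂) : dist p₁ p₂ ≤ K * dist z₁ z₂ := by
  have key : ∀ h : H, ⟪p₂ - p₁, h⟫ ≤ K / 2 * ‖h‖ ^ 2 + K / 2 * ‖z₂ - z₁‖ ^ 2 := fun h => by
    have a := h₂.lower_bound hw (z₂ + h)
    have b := h₁ (z₂ + h)
    have c := h₂ z₁
    have e := h₁.lower_bound hw z₂
    have f := h₁ z₂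
    have g := h₂.lower_bound hw z₁
    rw [add_sub_cancel_left] at a
    rw [show z₂ + h - z₁ = (z₂ - z₁) + h by abel, inner_add_right] at b
    rw [norm_sub_rev z₁ z₂, ← neg_sub z₂ z₁, inner_neg_right] at g
    rw [← neg_sub z₂ z₁, inner_neg_right] at c
    rw [inner_sub_left]
    linarith
  rw [dist_comm, dist_comm z₁, dist_eq_norm, dist_eq_norm]
  rcases eq_or_ne p₂ p₁ with h | h
  · have h0 : 0 ≤ K / 2 * ‖z₂ - z₁‖ ^ 2 := by simpa [h] using key (z₂ - z₁)
    subst h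
    simp only [sub_self, norm_zero]
    rcases (norm_nonneg (z₂ - z₁)).eq_or_lt with h' | h'
    · simp [← h']
    · by_contra! hK
      nlinarith
  · have hp : 0 < ‖p₂ - p₁‖ := norm_pos_iff.2 (sub_ne_zero.2 h)
    rcases (norm_nonneg (z₂ - z₁)).eq_or_lt with h' | h'
    · exfalso
      set t : ℝ := 1 / (|K| + 1)
      have ht : 0 < t := by positivity
      have h1 := key (t • (p₂ - p₁))
      rw [inner_smul_right, real_inner_self_eq_norm_sq, ← h', norm_smul, Real.norm_eq_abs,
        abs_of_pos ht, mul_pow] at h1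
      have h3 : K * t ≤ 1 := by
        simp only [t, mul_one_div]
        rw [div_le_one (by positivity)]
        linarith [le_abs_self K]
      have h4 : 0 < t * ‖p₂ - p₁‖ ^ 2 := by positivity
      nlinarith [mul_le_mul_of_nonneg_right h3 h4.le]
    · have h1 := key ((‖z₂ - z₁‖ / ‖p₂ - p₁‖) • (p₂ - p₁))
      rw [inner_smul_right, real_inner_self_eq_norm_sq, norm_smul, Real.norm_eq_abs,
        abs_of_pos (div_pos h' hp), div_mul_cancel₀ _ hp.ne'] at h1
      have h2 : ‖z₂ - z₁‖ / ‖p₂ - p₁‖ * ‖p₂ - p₁‖ ^ 2 = ‖z₂ - z₁‖ * ‖p₂ - p₁‖ := by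
        field_simp
      rw [h2] at h1
      nlinarith

lemma IsSemiconvexWith.continuous [FiniteDimensional ℝ H] {K : ℝ} {w : H → ℝ}
    (hw : IsSemiconvexWith K w) : Continuous w := by
  have hsub : ∀ z, ∃ p : H, ∀ y,
      w z + K / 2 * ‖z‖ ^ 2 + ⟪p, y - z⟫ ≤ w y + K / 2 * ‖y‖ ^ 2 := fun z => by
    obtain ⟨p, hp⟩ := hw z
    refine ⟨p + K • z, fun y => ?_⟩
    have h1 := hp y
    have h2 : ‖y‖ ^ 2 = ‖z‖ ^ 2 + 2 * ⟪z, y - z⟫ + ‖y - z‖ ^ 2 := by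
      rw [← norm_add_sq_real, add_sub_cancel]
    rw [inner_add_left, inner_smul_left, h2]
    simp only [conj_trivial]
    linarith
  have hconv : ConvexOn ℝ Set.univ fun y => w y + K / 2 * ‖y‖ ^ 2 := by
    refine ⟨convex_univ, fun x _ y _ a b ha hb hab => ?_⟩
    obtain ⟨p, hp⟩ := hsub (a • x + b • y)
    have h1 := mul_le_mul_of_nonneg_left (hp x) ha
    have h2 := mul_le_mul_of_nonneg_left (hp y) hb
    have h3 : a * ⟪p, x - (a • x + b • y)⟫ + b * ⟪p, y - (a • x + b • y)⟫ = 0 := by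
      rw [← inner_smul_right, ← inner_smul_right, ← inner_add_right]
      have : a • (x - (a • x + b • y)) + b • (y - (a • x + b • y)) = 0 := by
        rw [smul_sub, smul_sub, sub_add_sub_comm, ← add_smul, hab, one_smul, sub_self]
      rw [this, inner_zero_right]
    simp only [smul_eq_mul]
    have h4 : ∀ c : ℝ, c = a * c + b * c := fun c => by rw [← add_mul, hab, one_mul]
    have h5 := h4 (w (a • x + b • y) + K / 2 * ‖a • x + b • y‖ ^ 2)
    linarith
  refine (hconv.locallyLipschitz.continuous.sub
    (show Continuous fun y : H => K / 2 * ‖y‖ ^ 2 by fun_prop)).congr fun y => ?_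
  simp

/-- A coercive function is touched from above by hyperplanes of every slope. -/
lemma exists_isContact [FiniteDimensional ℝ H] {w : H → ℝ} (hc : Continuous w) {B β : ℝ}
    (hβ : 0 < β) (hB : ∀ y, w y ≤ B - β * ‖y‖ ^ 2) (p : H) : ∃ z, IsContact w z p := by
  have hcont : Continuous fun y => ⟪p, y⟫ - w y := by fun_prop
  have hlim : Tendsto (fun y => ⟪p, y⟫ - w y) (cocompact H) atTop := by
    have h1 : Tendsto (fun y : H => (β * ‖y‖ - ‖p‖) * ‖y‖ + (-B)) (cocompact H) atTop := by
      refine tendsto_atTop_add_const_right _ _ ?_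
      have hn := tendsto_norm_cocompact_atTop (E := H)
      exact (tendsto_atTop_add_const_right _ (-‖p‖) (hn.const_mul_atTop hβ)).atTop_mul_atTop₀ hn
    refine tendsto_atTop_mono (fun y => ?_) h1
    have h2 := abs_le.1 (abs_real_inner_le_norm p y)
    nlinarith [hB y, h2.1]
  obtain ⟨z, hz⟩ := hcont.exists_forall_le hlim
  refine ⟨z, fun y => ?_⟩
  have := hz y
  rw [inner_sub_right]
  linarith

open MeasureTheory in
open scoped Pointwise in
/-- Near a density point of `T`, every point is well approximated by elements of `T`. -/
lemma eventually_exists_mem_near_of_density [FiniteDimensional ℝ H] [MeasurableSpace H]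
    [BorelSpace H] (μ : Measure H) [μ.IsAddHaarMeasure] {T : Set H} {z : H}
    (hT : Tendsto (fun r => μ (T ∩ Metric.closedBall z r) / μ (Metric.closedBall z r))
      (𝓝[>] 0) (𝓝 1)) {κ : ℝ} (hκ : 0 < κ) :
    ∀ᶠ r in 𝓝[>] (0 : ℝ), ∀ y ∈ Metric.closedBall z r, ∃ t ∈ T, ‖t - y‖ ≤ κ * r := by
  obtain ⟨s, -, hsf, hs⟩ := finite_cover_balls_of_compact
    (isCompact_closedBall (0 : H) 1) (half_pos hκ)
  have hev : ∀ᶠ r in 𝓝[>] (0 : ℝ), ∀ c ∈ s,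
      (T ∩ ({z} + r • Metric.closedBall c (κ / 2))).Nonempty := by
    rw [Filter.eventually_all_finite hsf]
    exact fun c _ => Measure.eventually_nonempty_inter_smul_of_density_one μ T z hT _
      measurableSet_closedBall (Metric.measure_closedBall_pos μ c (half_pos hκ)).ne'
  filter_upwards [hev, self_mem_nhdsWithin] with r hr (hr0 : 0 < r) y hy
  have hy' : r⁻¹ • (y - z) ∈ Metric.closedBall (0 : H) 1 := by
    rw [mem_closedBall_zero_iff, norm_smul, norm_inv, Real.norm_eq_abs, abs_of_pos hr0,
      inv_mul_le_iff₀ hr0, mul_one, ← dist_eq_norm]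
    exact hy
  obtain ⟨c, hc, hyc⟩ := Set.mem_iUnion₂.1 (hs hy')
  obtain ⟨t, htT, ht⟩ := hr c hc
  obtain ⟨a, ha, b, hb, rfl⟩ := Set.mem_add.1 ht
  obtain ⟨e, he, rfl⟩ := Set.mem_smul_set.1 hb
  rw [Set.mem_singleton_iff] at ha
  subst ha
  refine ⟨_, htT, ?_⟩
  have h1 : a + r • e - y = r • ((e - c) - (r⁻¹ • (y - a) - c)) := by
    rw [sub_sub_sub_cancel_right, smul_sub, smul_inv_smul₀ hr0.ne']
    abel
  rw [h1, norm_smul, Real.norm_eq_abs, abs_of_pos hr0, mul_comm]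
  refine mul_le_mul_of_nonneg_right ?_ hr0.le
  rw [Metric.mem_closedBall, dist_eq_norm] at he
  rw [Metric.mem_ball, dist_eq_norm] at hyc
  linarith [norm_sub_le (e - c) (r⁻¹ • (y - a) - c)]

lemma IsContact.abs_sub_le {K : ℝ} (hK : 0 ≤ K) {w : H → ℝ} (hw : IsSemiconvexWith K w)
    {t g : H} (ht : IsContact w t g) {y y' : H} {s : ℝ} (hy : ‖y - t‖ ≤ s) (hy' : ‖y' - t‖ ≤ s) :
    |w y' - w y - ⟪g, y' - y⟫| ≤ K / 2 * s ^ 2 := by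
  have a := ht y
  have a' := ht y'
  have b := ht.lower_bound hw y
  have b' := ht.lower_bound hw y'
  have c : K / 2 * ‖y - t‖ ^ 2 ≤ K / 2 * s ^ 2 := by gcongr
  have c' : K / 2 * ‖y' - t‖ ^ 2 ≤ K / 2 * s ^ 2 := by gcongr
  rw [show y' - y = (y' - t) - (y - t) by abel, inner_sub_right, abs_le]
  constructor <;> linarith

/-- Second-order expansion of a semiconvex function along a segment, from approximate knowledge of
its gradients at contact points near a subdivision of the segment. -/
lemma abs_secondOrder_remainder_le {K : ℝ} (hK : 0 ≤ K) {w : H → ℝ} (hw : IsSemiconvexWith K w)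
    {z p h : H} {A : H →L[ℝ] H} {m : ℕ} (hm : 0 < m) {τ : ℝ}
    (hpts : ∀ k < m, ∃ t g, IsContact w t g ∧ ‖t - (z + ((k : ℝ) / m) • h)‖ ≤ ‖h‖ / m ∧
      ‖g - p - A (t - z)‖ ≤ τ * ‖h‖) :
    |w (z + h) - w z - ⟪p, h⟫ - 1 / 2 * ⟪A h, h⟫| ≤
      ((2 * K + 2 * ‖A‖) / m + τ) * ‖h‖ ^ 2 := by
  have hm' : (0 : ℝ) < m := by exact_mod_cast hm
  set y : ℕ → H := fun k => z + ((k : ℝ) / m) • h with hydef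
  set q : ℕ → ℝ := fun k => ⟪p, h⟫ / m + (k : ℝ) / m ^ 2 * ⟪A h, h⟫ with hq
  have hstep : ∀ k < m, |w (y (k + 1)) - w (y k) - q k| ≤
      (2 * K / m + ‖A‖ / m + τ) * ‖h‖ ^ 2 / m := fun k hk => by
    obtain ⟨t, g, ht, htn, hg⟩ := hpts k hk
    have hd : y (k + 1) - y k = (1 / m : ℝ) • h := by
      simp only [hydef, add_sub_add_left_eq_sub, ← sub_smul]
      congr 1
      push_cast
      field_simp
      ring
    have hdn : ‖y (k + 1) - y k‖ = ‖h‖ / m := by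
      rw [hd, norm_smul, Real.norm_eq_abs, abs_of_pos (by positivity)]
      ring
    have e1 : ‖y k - t‖ ≤ ‖h‖ / m := by rw [norm_sub_rev]; exact htn
    have e2 : ‖y (k + 1) - t‖ ≤ 2 * (‖h‖ / m) := by
      rw [show y (k + 1) - t = (y (k + 1) - y k) + (y k - t) by abel]
      linarith [norm_add_le (y (k + 1) - y k) (y k - t)]
    have e0 : 0 ≤ ‖h‖ / m := by positivity
    have e3 := ht.abs_sub_le hK hw (show ‖y k - t‖ ≤ 2 * (‖h‖ / m) by linarith) e2
    have e4 : ⟪g, y (k + 1) - y k⟫ - q k =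
        (⟪g - p - A (t - z), h⟫ + ⟪A (t - y k), h⟫) / m := by
      have : t - z = (t - y k) + ((k : ℝ) / m) • h := by simp only [hydef]; abel
      rw [hd, hq, this, map_add, map_smul]
      simp only [inner_smul_right, inner_sub_left, inner_add_left, inner_smul_left, conj_trivial]
      field_simp
      ring
    have e5 : |⟪g - p - A (t - z), h⟫ + ⟪A (t - y k), h⟫| ≤ (‖A‖ / m + τ) * ‖h‖ ^ 2 := by
      have f1 := (abs_real_inner_le_norm (g - p - A (t - z)) h).trans
        (mul_le_mul_of_nonneg_right hg (norm_nonneg h))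
      have f2 := (abs_real_inner_le_norm (A (t - y k)) h).trans
        (mul_le_mul_of_nonneg_right ((A.le_opNorm _).trans
          (mul_le_mul_of_nonneg_left htn (norm_nonneg A))) (norm_nonneg h))
      refine (abs_add_le _ _).trans ((add_le_add f1 f2).trans (le_of_eq ?_))
      ring
    calc |w (y (k + 1)) - w (y k) - q k|
        = |(w (y (k + 1)) - w (y k) - ⟪g, y (k + 1) - y k⟫) + (⟪g, y (k + 1) - y k⟫ - q k)| := by
          congr 1; ring
      _ ≤ K / 2 * (2 * (‖h‖ / m)) ^ 2 + (‖A‖ / m + τ) * ‖h‖ ^ 2 / m := by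
          refine (abs_add_le _ _).trans (add_le_add e3 ?_)
          rw [e4, abs_div, abs_of_pos hm']
          gcongr
      _ = _ := by field_simp; ring
  have hsum := (Finset.abs_sum_le_sum_abs (fun k => w (y (k + 1)) - w (y k) - q k)
    (Finset.range m)).trans (Finset.sum_le_sum fun k hk => hstep k (Finset.mem_range.1 hk))
  have hy0 : y 0 = z := by simp [hydef]
  have hym : y m = z + h := by simp [hydef, div_self hm'.ne']
  have hid : ∀ n : ℕ, ∑ k ∈ Finset.range n, q k =
      n * (⟪p, h⟫ / m) + (n * (n - 1) / 2 : ℝ) / m ^ 2 * ⟪A h, h⟫ := fun n => by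
    induction n with
    | zero => simp
    | succ n ih => rw [Finset.sum_range_succ, ih]; simp only [hq]; push_cast; ring
  rw [Finset.sum_sub_distrib, Finset.sum_range_sub (fun k => w (y k)), hid, hy0, hym,
    Finset.sum_const, Finset.card_range, nsmul_eq_mul] at hsum
  have hA : |⟪A h, h⟫| ≤ ‖A‖ * ‖h‖ ^ 2 := by
    refine (abs_real_inner_le_norm _ _).trans ?_
    nlinarith [A.le_opNorm h, norm_nonneg h]
  have hA2 : |1 / (2 * m) * ⟪A h, h⟫| ≤ ‖A‖ * ‖h‖ ^ 2 / m := by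
    rw [abs_mul, abs_of_pos (by positivity : (0 : ℝ) < 1 / (2 * m))]
    calc 1 / (2 * m) * |⟪A h, h⟫| ≤ 1 / (2 * m) * (‖A‖ * ‖h‖ ^ 2) := by gcongr
      _ = (‖A‖ * ‖h‖ ^ 2 / m) / 2 := by field_simp
      _ ≤ _ := half_le_self (by positivity)
  calc |w (z + h) - w z - ⟪p, h⟫ - 1 / 2 * ⟪A h, h⟫|
      = |(w (z + h) - w z - (m * (⟪p, h⟫ / m) + (m * (m - 1) / 2 : ℝ) / m ^ 2 * ⟪A h, h⟫)) -
          1 / (2 * m) * ⟪A h, h⟫| := by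
        congr 1
        field_simp
        ring
    _ ≤ m * ((2 * K / m + ‖A‖ / m + τ) * ‖h‖ ^ 2 / m) + ‖A‖ * ‖h‖ ^ 2 / m :=
        (abs_sub _ _).trans (add_le_add hsum hA2)
    _ = _ := by field_simp; ring

open MeasureTheory Module in
/-- **Jensen–Alexandrov lemma**: a coercive semiconvex function has contact points of
arbitrarily small slope at which it has a second-order expansion. -/
theorem exists_isContact_secondOrder [FiniteDimensional ℝ H] {K B β r : ℝ} (hK : 0 ≤ K)
    {w : H → ℝ} (hw : IsSemiconvexWith K w) (hβ : 0 < β) (hB : ∀ y, w y ≤ B - β * ‖y‖ ^ 2)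
    (hr : 0 < r) :
    ∃ (z p : H) (A : H →L[ℝ] H), ‖p‖ ≤ r ∧ IsContact w z p ∧ ∀ κ > 0, ∀ᶠ h in 𝓝 (0 : H),
      |w (z + h) - w z - ⟪p, h⟫ - 1 / 2 * ⟪A h, h⟫| ≤ κ * ‖h‖ ^ 2 := by
  let _ : MeasurableSpace H := borel H
  have _ : BorelSpace H := ⟨rfl⟩
  set μ : Measure H := μH[finrank ℝ H]
  set T : Set H := {z | ∃ p, ‖p‖ ≤ r ∧ IsContact w z p} with hTdef
  choose! g hgr hg using fun z (hz : z ∈ T) => hz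
  have hlip : LipschitzOnWith K.toNNReal g T := LipschitzOnWith.of_dist_le_mul fun x hx y hy => by
    rw [Real.coe_toNNReal K hK]
    exact (hg x hx).dist_le hw (hg y hy)
  have himage : Metric.closedBall (0 : H) r ⊆ g '' T := fun p hp => by
    obtain ⟨z, hz⟩ := exists_isContact hw.continuous hβ hB p
    have hzT : z ∈ T := ⟨p, mem_closedBall_zero_iff.1 hp, hz⟩
    refine ⟨z, hzT, ?_⟩
    have := (hg z hzT).dist_le hw hz
    rw [dist_self, mul_zero] at this
    exact dist_le_zero.1 this
  have hμT : μ T ≠ 0 := fun h0 => by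
    have h1 := hlip.hausdorffMeasure_image_le (d := finrank ℝ H) (Nat.cast_nonneg _)
    have h2 : μ (g '' T) = 0 := by
      refine le_antisymm (h1.trans ?_) bot_le
      change _ * μ T ≤ _
      rw [h0, mul_zero]
    exact (Metric.measure_closedBall_pos μ (0 : H) hr).ne' (measure_mono_null himage h2)
  obtain ⟨G, hGlip, hGeq⟩ := hlip.extend_finite_dimension
  obtain ⟨z, hzT, hdens, hdiff⟩ : ∃ z ∈ T, Tendsto
      (fun r => μ (T ∩ Metric.closedBall z r) / μ (Metric.closedBall z r)) (𝓝[>] 0) (𝓝 1) ∧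
      DifferentiableAt ℝ G z := by
    by_contra! hcon
    have hae := (Besicovitch.ae_tendsto_measure_inter_div μ T).and
      (ae_restrict_of_ae (s := T) (hGlip.ae_differentiableAt (μ := μ)))
    have h0 := nonpos_iff_eq_zero.1
      ((Measure.le_restrict_apply T _).trans_eq (mem_ae_iff.1 hae))
    refine hμT (measure_mono_null (fun z hz => ?_) h0)
    exact ⟨fun h => hcon z hz h.1 h.2, hz⟩
  set A := fderiv ℝ G z
  refine ⟨z, g z, A, hgr z hzT, hg z hzT, fun κ hκ => ?_⟩
  obtain ⟨m, hm⟩ := exists_nat_gt ((2 * K + 2 * ‖A‖ + 2) / κ)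
  have hm0 : (0 : ℝ) < m := lt_of_le_of_lt (by positivity) hm
  have hGz : ∀ᶠ t in 𝓝 z, ‖G t - G z - A (t - z)‖ ≤ 1 / m * ‖t - z‖ :=
    hdiff.hasFDerivAt.isLittleO.bound (by positivity)
  obtain ⟨ρ₁, hρ₁, hball⟩ := Metric.eventually_nhds_iff.1 hGz
  obtain ⟨ρ₂, hρ₂, hnear⟩ := mem_nhdsGT_iff_exists_Ioo_subset.1
    (eventually_exists_mem_near_of_density μ hdens (κ := 1 / m) (by positivity))
  refine Metric.eventually_nhds_iff.2 ⟨min (ρ₁ / 2) ρ₂, lt_min (half_pos hρ₁) hρ₂, fun h hh => ?_⟩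
  rw [dist_zero_right, lt_min_iff] at hh
  rcases eq_or_ne h 0 with rfl | hne
  · simp
  have hh0 : 0 < ‖h‖ := norm_pos_iff.2 hne
  have hm1 : (1 : ℝ) ≤ m := by exact_mod_cast Nat.cast_pos.1 hm0
  refine (abs_secondOrder_remainder_le hK hw (m := m) (τ := 2 / m) (Nat.cast_pos.1 hm0)
    fun k hk => ?_).trans ?_
  · have hkm : (k : ℝ) / m ≤ 1 := by
      rw [div_le_one hm0]
      exact_mod_cast hk.le
    have hkn : ‖((k : ℝ) / m) • h‖ ≤ ‖h‖ := by
      rw [norm_smul, Real.norm_eq_abs, abs_of_nonneg (by positivity)]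
      nlinarith
    obtain ⟨t, htT, ht⟩ := hnear ⟨hh0, hh.2⟩ (z + ((k : ℝ) / m) • h) (by
      rwa [Metric.mem_closedBall, dist_eq_norm, add_sub_cancel_left])
    rw [one_div_mul_eq_div] at ht
    have htz : ‖t - z‖ ≤ 2 * ‖h‖ := by
      rw [show t - z = (t - (z + ((k : ℝ) / m) • h)) + ((k : ℝ) / m) • h by abel]
      refine (norm_add_le _ _).trans ?_
      linarith [div_le_self hh0.le hm1]
    refine ⟨t, g t, hg t htT, ht, ?_⟩
    rw [hGeq htT, hGeq hzT]
    refine (hball (by rw [dist_eq_norm]; linarith [hh.1])).trans ?_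
    calc 1 / (m : ℝ) * ‖t - z‖ ≤ 1 / m * (2 * ‖h‖) := by gcongr
      _ = 2 / m * ‖h‖ := by ring
  · gcongr
    rw [← add_div, div_le_iff₀ hm0]
    rw [div_lt_iff₀ hκ] at hm
    linarith

/-- The Jensen–Alexandrov lemma for functions of two variables. -/
lemma exists_prod_contact_secondOrder [FiniteDimensional ℝ H] {K B β r : ℝ} (hK : 0 ≤ K)
    {w : H → H → ℝ}
    (hw : ∀ x y, ∃ p q : H, ∀ x' y', w x y + (⟪p, x' - x⟫ + ⟪q, y' - y⟫) -
      K / 2 * (‖x' - x‖ ^ 2 + ‖y' - y‖ ^ 2) ≤ w x' y')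
    (hβ : 0 < β) (hB : ∀ x y, w x y ≤ B - β * (‖x‖ ^ 2 + ‖y‖ ^ 2)) (hr : 0 < r) :
    ∃ (x y p q : H) (A₁ A₂ : H →L[ℝ] H), ‖p‖ ≤ r ∧ ‖q‖ ≤ r ∧
      (∀ x' y', w x' y' ≤ w x y + (⟪p, x' - x⟫ + ⟪q, y' - y⟫)) ∧
      (∀ κ > 0, ∀ᶠ h in 𝓝 (0 : H),
        |w (x + h) y - w x y - ⟪p, h⟫ - 1 / 2 * ⟪A₁ h, h⟫| ≤ κ * ‖h‖ ^ 2) ∧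
      (∀ κ > 0, ∀ᶠ h in 𝓝 (0 : H),
        |w x (y + h) - w x y - ⟪q, h⟫ - 1 / 2 * ⟪A₂ h, h⟫| ≤ κ * ‖h‖ ^ 2) := by
  let e := (WithLp.prodContinuousLinearEquiv 2 ℝ H H).symm.toContinuousLinearMap
  let f := (WithLp.prodContinuousLinearEquiv 2 ℝ H H).toContinuousLinearMap
  let ι₁ : H →L[ℝ] WithLp 2 (H × H) := e ∘L ContinuousLinearMap.inl ℝ H H
  let ι₂ : H →L[ℝ] WithLp 2 (H × H) := e ∘L ContinuousLinearMap.inr ℝ H H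
  let π₁ : WithLp 2 (H × H) →L[ℝ] H := ContinuousLinearMap.fst ℝ H H ∘L f
  let π₂ : WithLp 2 (H × H) →L[ℝ] H := ContinuousLinearMap.snd ℝ H H ∘L f
  have hsc : IsSemiconvexWith K fun z : WithLp 2 (H × H) => w z.fst z.snd := fun z => by
    obtain ⟨p, q, hpq⟩ := hw z.fst z.snd
    refine ⟨WithLp.toLp 2 (p, q), fun y => ?_⟩
    rw [WithLp.prod_inner_apply, WithLp.prod_norm_sq_eq_of_L2]
    exact hpq y.fst y.snd
  obtain ⟨z, p, A, hp, hz, hA⟩ := exists_isContact_secondOrder hK hsc hβ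
    (B := B) (fun y => by rw [WithLp.prod_norm_sq_eq_of_L2]; exact hB _ _) hr
  have hp2 := WithLp.prod_norm_sq_eq_of_L2 p
  have hι₁ : ∀ h, ‖ι₁ h‖ ^ 2 = ‖h‖ ^ 2 := fun h => by
    rw [WithLp.prod_norm_sq_eq_of_L2]
    simp [ι₁, e]
  have hι₂ : ∀ h, ‖ι₂ h‖ ^ 2 = ‖h‖ ^ 2 := fun h => by
    rw [WithLp.prod_norm_sq_eq_of_L2]
    simp [ι₂, e]
  refine ⟨z.fst, z.snd, p.fst, p.snd, π₁ ∘L A ∘L ι₁, π₂ ∘L A ∘L ι₂,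
    abs_le_of_sq_le_sq' ?_ hr.le |>.2, abs_le_of_sq_le_sq' ?_ hr.le |>.2, fun x' y' => ?_,
    fun κ hκ => ?_, fun κ hκ => ?_⟩
  · nlinarith [norm_nonneg p, sq_nonneg ‖p.snd‖]
  · nlinarith [norm_nonneg p, sq_nonneg ‖p.fst‖]
  · have h := hz (WithLp.toLp 2 (x', y'))
    rw [WithLp.prod_inner_apply] at h
    exact h
  · have ht : Tendsto ι₁ (𝓝 0) (𝓝 0) := by simpa using ι₁.continuous.tendsto 0
    filter_upwards [ht.eventually (hA κ hκ)] with h hh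
    rw [hι₁] at hh
    simpa [WithLp.prod_inner_apply, ι₁, e, π₁, f] using hh
  · have ht : Tendsto ι₂ (𝓝 0) (𝓝 0) := by simpa using ι₂.continuous.tendsto 0
    filter_upwards [ht.eventually (hA κ hκ)] with h hh
    rw [hι₂] at hh
    simpa [WithLp.prod_inner_apply, ι₂, e, π₂, f] using hh

/-- The supremum defining the sup-convolution of a bounded continuous function is attained. -/
lemma exists_supConvolution_argmax [FiniteDimensional ℝ H] {u : H → ℝ} (hu : Continuous u) {B : ℝ}
    (hB : ∀ x, |u x| ≤ B) {k : ℝ} (hk : 0 < k) (x : H) :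
    ∃ s, ∀ y, u y - k / 2 * ‖x - y‖ ^ 2 ≤ u s - k / 2 * ‖x - s‖ ^ 2 := by
  have hcont : Continuous fun y => u (x - y) - k / 2 * ‖y‖ ^ 2 := by fun_prop
  obtain ⟨z, hz⟩ := exists_isContact hcont (half_pos hk)
    (fun y => sub_le_sub_right (le_of_abs_le (hB (x - y))) _) 0
  refine ⟨x - z, fun y => ?_⟩
  have := hz (x - y)
  simpa using this

/-- The sup-convolution of a bounded continuous function, together with the points where it is
attained. -/
lemma exists_supConvolution [FiniteDimensional ℝ H] {u : H → ℝ} (hu : Continuous u) {B : ℝ}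
    (hB : ∀ x, |u x| ≤ B) {k : ℝ} (hk : 0 < k) :
    ∃ (U : H → ℝ) (s : H → H), (∀ x, U x = u (s x) - k / 2 * ‖x - s x‖ ^ 2) ∧
      (∀ x y, u y - k / 2 * ‖x - y‖ ^ 2 ≤ U x) ∧ (∀ x, u x ≤ U x) ∧ (∀ x, U x ≤ B) ∧
      (∀ x, k * ‖x - s x‖ ^ 2 ≤ 4 * B) ∧ IsSemiconvexWith k U := by
  choose s hs using exists_supConvolution_argmax hu hB hk
  have hle : ∀ x, u x ≤ u (s x) - k / 2 * ‖x - s x‖ ^ 2 := fun x => by simpa using hs x x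
  have hub := fun x => abs_le.1 (hB x)
  refine ⟨fun x => u (s x) - k / 2 * ‖x - s x‖ ^ 2, s, fun _ => rfl, hs, hle, fun x => ?_,
    fun x => ?_, fun x => ⟨k • (s x - x), fun y => ?_⟩⟩
  · have : 0 ≤ k / 2 * ‖x - s x‖ ^ 2 := by positivity
    dsimp only
    linarith [(hub (s x)).2]
  · linarith [hle x, (hub x).1, (hub (s x)).2]
  · refine le_trans (le_of_eq ?_) (hs y (s x))
    have h : ‖y - s x‖ ^ 2 = ‖x - s x‖ ^ 2 - 2 * ⟪s x - x, y - x⟫ + ‖y - x‖ ^ 2 := by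
      rw [show y - s x = (y - x) - (s x - x) by abel, norm_sub_sq_real, norm_sub_rev x,
        real_inner_comm]
      ring
    rw [h, inner_smul_left]
    simp only [conj_trivial]
    ring

/-- The quadratic polynomial with gradient `P` and Hessian `A` at `x`. -/
def quadTest (x P : H) (A : H →L[ℝ] H) (y : H) : ℝ :=
  ⟪P, y - x⟫ + 1 / 2 * ⟪A (y - x), y - x⟫

/-- The penalty used to double the variables. -/
def doublingPenalty (a β : ℝ) (x y : H) : ℝ :=
  a / 2 * ‖x - y‖ ^ 2 + β / 2 * (‖x‖ ^ 2 + ‖y‖ ^ 2)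

lemma doublingPenalty_add (a β : ℝ) (x y ξ ζ : H) :
    doublingPenalty a β (x + ξ) (y + ζ) = doublingPenalty a β x y +
      (⟪a • (x - y) + β • x, ξ⟫ + ⟪-(a • (x - y)) + β • y, ζ⟫) + doublingPenalty a β ξ ζ := by
  unfold doublingPenalty
  rw [show x + ξ - (y + ζ) = (x - y) + (ξ - ζ) by abel, norm_add_sq_real (x - y),
    norm_add_sq_real x, norm_add_sq_real y]
  simp only [inner_add_left, inner_neg_left, inner_smul_left, inner_sub_right, conj_trivial]
  ring

lemma doublingPenalty_nonneg {F : Type*} [NormedAddCommGroup F] {a β : ℝ} (ha : 0 ≤ a)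
    (hβ : 0 ≤ β) (x y : F) :
    0 ≤ doublingPenalty a β x y := by
  unfold doublingPenalty
  positivity

lemma doublingPenalty_le {a β : ℝ} (ha : 0 ≤ a) (x y : H) :
    doublingPenalty a β x y ≤ (2 * a + β) / 2 * (‖x‖ ^ 2 + ‖y‖ ^ 2) := by
  have h : ‖x - y‖ ^ 2 ≤ 2 * (‖x‖ ^ 2 + ‖y‖ ^ 2) := by
    nlinarith [parallelogram_law_with_norm ℝ x y, sq_nonneg ‖x + y‖]
  unfold doublingPenalty
  nlinarith [mul_le_mul_of_nonneg_left h ha]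

lemma isLocalMax_sub_quadTest {u : H → ℝ} {x P : H} {A : H →L[ℝ] H}
    (h : ∀ᶠ h in 𝓝 (0 : H), u (x + h) ≤ u x + ⟪P, h⟫ + 1 / 2 * ⟪A h, h⟫) :
    IsLocalMax (fun y => u y - quadTest x P A y) x := by
  have ht : Tendsto (fun y => y - x) (𝓝 x) (𝓝 0) := by
    have : Continuous fun y : H => y - x := by fun_prop
    simpa using this.tendsto x
  filter_upwards [ht.eventually h] with y hy
  rw [add_sub_cancel] at hy
  simp only [quadTest, sub_self, inner_zero_right, map_zero]
  linarith

lemma hessian_le_of_contact {U V : H → ℝ} {a β : ℝ} {x y P Q : H} {A₁ A₂ : H →L[ℝ] H}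
    (hUV : ∀ ξ ζ, U (x + ξ) + V (y + ζ) ≤
      U x + V y + (⟪P, ξ⟫ + ⟪Q, ζ⟫) + doublingPenalty a β ξ ζ)
    (hU : ∀ κ > 0, ∀ᶠ h in 𝓝 (0 : H),
      |U (x + h) - U x - ⟪P, h⟫ - 1 / 2 * ⟪A₁ h, h⟫| ≤ κ * ‖h‖ ^ 2)
    (hV : ∀ κ > 0, ∀ᶠ h in 𝓝 (0 : H),
      |V (y + h) - V y - ⟪Q, h⟫ - 1 / 2 * ⟪A₂ h, h⟫| ≤ κ * ‖h‖ ^ 2) (ξ ζ : H) :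
    ⟪A₁ ξ, ξ⟫ + ⟪A₂ ζ, ζ⟫ ≤ 2 * doublingPenalty a β ξ ζ := by
  have key : ∀ κ > 0, ⟪A₁ ξ, ξ⟫ + ⟪A₂ ζ, ζ⟫ ≤
      2 * doublingPenalty a β ξ ζ + κ * (2 * (‖ξ‖ ^ 2 + ‖ζ‖ ^ 2)) := fun κ hκ => by
    have ht : ∀ h : H, Tendsto (fun t : ℝ => t • h) (𝓝[>] 0) (𝓝 0) := fun h => by
      have : Continuous fun t : ℝ => t • h := by fun_prop
      simpa using (this.tendsto 0).mono_left nhdsWithin_le_nhds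
    obtain ⟨t, ⟨h1, h2⟩, ht0 : 0 < t⟩ := (((ht ξ).eventually (hU κ hκ)).and
      ((ht ζ).eventually (hV κ hκ))).and self_mem_nhdsWithin |>.exists
    have h3 := hUV (t • ξ) (t • ζ)
    have h4 : doublingPenalty a β (t • ξ) (t • ζ) = t ^ 2 * doublingPenalty a β ξ ζ := by
      simp only [doublingPenalty, ← smul_sub, norm_smul, Real.norm_eq_abs, mul_pow, sq_abs]
      ring
    rw [h4] at h3
    have h5 := (abs_le.1 h1).1
    have h6 := (abs_le.1 h2).1
    simp only [map_smul, inner_smul_left, inner_smul_right, norm_smul, Real.norm_eq_abs, mul_pow,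
      sq_abs, conj_trivial] at h3 h5 h6
    refine le_of_mul_le_mul_left ?_ (by positivity : (0 : ℝ) < t ^ 2)
    linarith
  refine le_of_forall_pos_le_add fun e he => ?_
  have hN : 0 < 2 * (‖ξ‖ ^ 2 + ‖ζ‖ ^ 2) + 1 := by positivity
  refine (key (e / (2 * (‖ξ‖ ^ 2 + ‖ζ‖ ^ 2) + 1)) (by positivity)).trans ?_
  gcongr
  rw [div_mul_eq_mul_div, div_le_iff₀ hN]
  nlinarith

set_option maxHeartbeats 1000000 in
/-- **Theorem on sums** for the quadratic penalty, in approximate form: near-maximisers of the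
doubled function carry quadratic test functions with the expected gradients and Hessians. -/
theorem exists_quadTest_of_doubling [FiniteDimensional ℝ H] {u v : H → ℝ} (hu : Continuous u)
    (hv : Continuous v) {B : ℝ} (hBu : ∀ x, |u x| ≤ B) (hBv : ∀ x, |v x| ≤ B) {a β η : ℝ}
    (ha : 0 ≤ a) (hβ : 0 < β) (hη : 0 < η) (x₀ y₀ : H) :
    ∃ (x y P Q : H) (A₁ A₂ : H →L[ℝ] H),
      IsLocalMax (fun z => u z - quadTest x P A₁ z) x ∧
      IsLocalMin (fun z => v z - quadTest y Q A₂ z) y ∧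
      u x₀ - v y₀ - doublingPenalty a β x₀ y₀ ≤ u x - v y - doublingPenalty a β x y + η ∧
      ‖P - (a • (x - y) + β • x)‖ ≤ η ∧ ‖Q - (a • (x - y) - β • y)‖ ≤ η ∧
      ∀ ξ ζ, ⟪A₁ ξ, ξ⟫ - ⟪A₂ ζ, ζ⟫ ≤ a * ‖ξ - ζ‖ ^ 2 + (β + η) * (‖ξ‖ ^ 2 + ‖ζ‖ ^ 2) := by
  have hB0 : 0 ≤ B := (abs_nonneg _).trans (hBu x₀)
  set c₀ := 4 * B + doublingPenalty a β x₀ y₀ + (‖x₀‖ + ‖y₀‖) with hc₀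
  have hpen₀ := doublingPenalty_nonneg ha hβ.le x₀ y₀
  have hc₀' : 0 ≤ c₀ := by positivity
  set R := 1 + 4 * (c₀ + 2) / β with hR
  have hR1 : 1 ≤ R := by
    have : 0 ≤ 4 * (c₀ + 2) / β := by positivity
    linarith
  obtain ⟨s, hs0, hs1, hs⟩ : ∃ s : ℝ, 0 < s ∧ s ≤ 1 ∧ (2 * a + β) * (2 * R + 1) * s ≤ η / 2 := by
    have hD : 0 < (2 * a + β) * (2 * R + 1) := by positivity
    refine ⟨min 1 (η / 2 / ((2 * a + β) * (2 * R + 1))), by positivity, min_le_left _ _, ?_⟩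
    rw [← le_div_iff₀' hD]
    exact min_le_right _ _
  obtain ⟨r, hr0, hr1, hr⟩ : ∃ r : ℝ, 0 < r ∧ r ≤ 1 ∧ r * (‖x₀‖ + ‖y₀‖ + 2 * R) ≤ η / 2 := by
    have hD : 0 < ‖x₀‖ + ‖y₀‖ + 2 * R := by positivity
    refine ⟨min 1 (η / 2 / (‖x₀‖ + ‖y₀‖ + 2 * R)), by positivity, min_le_left _ _, ?_⟩
    rw [← le_div_iff₀ hD]
    exact min_le_right _ _
  set k := (4 * B + 1) / s ^ 2 with hk
  have hk0 : 0 < k := by positivity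
  have hks : ∀ n : ℝ, k * n ^ 2 ≤ 4 * B → n ≤ s := fun n hn => by
    by_contra! h
    have h1 : k * s ^ 2 = 4 * B + 1 := by rw [hk]; field_simp
    have h2 : k * s ^ 2 ≤ k * n ^ 2 := by gcongr
    linarith
  obtain ⟨U, sU, hU₁, hU₂, hU₃, hU₄, hU₅, hU₆⟩ := exists_supConvolution hu hBu hk0
  obtain ⟨V, sV, hV₁, hV₂, hV₃, hV₄, hV₅, hV₆⟩ := exists_supConvolution (u := fun x => -v x)
    hv.neg (fun x => by rw [abs_neg]; exact hBv x) hk0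
  obtain ⟨x, y, p, q, A₁, A₂, hp, hq, hcontact, hA₁, hA₂⟩ := exists_prod_contact_secondOrder
    (w := fun x y => U x + V y - doublingPenalty a β x y) (K := k + (2 * a + β)) (B := 2 * B)
    (β := β / 2) (r := r) (by positivity) (fun x y => by
      obtain ⟨pU, hpU⟩ := hU₆ x
      obtain ⟨pV, hpV⟩ := hV₆ y
      refine ⟨pU - (a • (x - y) + β • x), pV - (-(a • (x - y)) + β • y), fun x' y' => ?_⟩
      have h1 := doublingPenalty_add a β x y (x' - x) (y' - y)
      have h2 := doublingPenalty_le (β := β) ha (x' - x) (y' - y)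
      rw [add_sub_cancel, add_sub_cancel] at h1
      rw [inner_sub_left pU, inner_sub_left pV]
      linarith [hpU x', hpV y'])
    (half_pos hβ) (fun x y => by
      have : 0 ≤ a / 2 * ‖x - y‖ ^ 2 := by positivity
      unfold doublingPenalty
      linarith [hU₄ x, hV₄ y]) hr0
  set P := p + (a • (x - y) + β • x) with hP
  set Q := q + (-(a • (x - y)) + β • y) with hQ
  set I := ContinuousLinearMap.id ℝ H
  have hI : ∀ (A : H →L[ℝ] H) (c : ℝ) (h : H), ⟪(A + c • I) h, h⟫ = ⟪A h, h⟫ + c * ‖h‖ ^ 2 :=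
    fun A c h => by
      change ⟪A h + c • h, h⟫ = _
      rw [inner_add_left, real_inner_smul_left, real_inner_self_eq_norm_sq]
  have hUV : ∀ ξ ζ, U (x + ξ) + V (y + ζ) ≤
      U x + V y + (⟪P, ξ⟫ + ⟪Q, ζ⟫) + doublingPenalty a β ξ ζ := fun ξ ζ => by
    have h1 := hcontact (x + ξ) (y + ζ)
    rw [doublingPenalty_add, add_sub_cancel_left, add_sub_cancel_left] at h1
    rw [hP, hQ, inner_add_left p, inner_add_left q]
    linarith
  have hUexp : ∀ κ > 0, ∀ᶠ h in 𝓝 (0 : H),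
      |U (x + h) - U x - ⟪P, h⟫ - 1 / 2 * ⟪(A₁ + (a + β) • I) h, h⟫| ≤ κ * ‖h‖ ^ 2 :=
    fun κ hκ => by
      filter_upwards [hA₁ κ hκ] with h hh
      convert hh using 2
      have h1 := doublingPenalty_add a β x y h 0
      rw [add_zero] at h1
      rw [h1, hI, hP, inner_add_left p]
      simp only [inner_zero_right, doublingPenalty, sub_zero, norm_zero]
      ring
  have hVexp : ∀ κ > 0, ∀ᶠ h in 𝓝 (0 : H),
      |V (y + h) - V y - ⟪Q, h⟫ - 1 / 2 * ⟪(A₂ + (a + β) • I) h, h⟫| ≤ κ * ‖h‖ ^ 2 :=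
    fun κ hκ => by
      filter_upwards [hA₂ κ hκ] with h hh
      convert hh using 2
      have h1 := doublingPenalty_add a β x y 0 h
      rw [add_zero] at h1
      rw [h1, hI, hQ, inner_add_left q]
      simp only [inner_zero_right, doublingPenalty, zero_sub, norm_zero, norm_neg]
      ring
  have hhess := hessian_le_of_contact hUV hUexp hVexp
  have hxs := hks _ (hU₅ x)
  have hys := hks _ (hV₅ y)
  have hcon₀ := hcontact x₀ y₀
  have hpx : ⟪p, x₀ - x⟫ ≤ r * (‖x₀‖ + ‖x‖) := (real_inner_le_norm _ _).trans
    (mul_le_mul hp (norm_sub_le _ _) (norm_nonneg _) hr0.le)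
  have hqy : ⟪q, y₀ - y⟫ ≤ r * (‖y₀‖ + ‖y‖) := (real_inner_le_norm _ _).trans
    (mul_le_mul hq (norm_sub_le _ _) (norm_nonneg _) hr0.le)
  have hbound : ‖x‖ + ‖y‖ ≤ R := by
    by_contra! hcon
    have h1 : r * (‖x₀‖ + ‖x‖) + r * (‖y₀‖ + ‖y‖) ≤ (‖x₀‖ + ‖x‖) + (‖y₀‖ + ‖y‖) := by
      have e1 : 0 ≤ ‖x₀‖ + ‖x‖ := by positivity
      have e2 : 0 ≤ ‖y₀‖ + ‖y‖ := by positivity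
      nlinarith
    have h2 : β / 2 * (‖x‖ ^ 2 + ‖y‖ ^ 2) ≤ doublingPenalty a β x y := by
      have : 0 ≤ a / 2 * ‖x - y‖ ^ 2 := by positivity
      unfold doublingPenalty
      linarith
    have h3 : (‖x‖ + ‖y‖) ^ 2 ≤ 2 * (‖x‖ ^ 2 + ‖y‖ ^ 2) := by nlinarith [sq_nonneg (‖x‖ - ‖y‖)]
    have h4 : β / 4 * (‖x‖ + ‖y‖) ^ 2 ≤ c₀ + (‖x‖ + ‖y‖) := by
      have e1 := hU₄ x
      have e2 := hV₄ y
      have e3 := (neg_le_of_abs_le (hBu x₀)).trans (hU₃ x₀)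
      have e4 : -B ≤ V y₀ := (neg_le_neg (le_of_abs_le (hBv y₀))).trans (hV₃ y₀)
      nlinarith [mul_le_mul_of_nonneg_left h3 hβ.le]
    have h5 : (c₀ + 2) < β / 4 * (‖x‖ + ‖y‖) := by
      have : 4 * (c₀ + 2) / β < ‖x‖ + ‖y‖ := by linarith
      rw [div_lt_iff₀ hβ] at this
      linarith
    have h6 : 1 < ‖x‖ + ‖y‖ := by linarith
    have h7 := mul_lt_mul_of_pos_right h5 (by linarith : 0 < ‖x‖ + ‖y‖)
    have h8 := mul_le_mul_of_nonneg_left h6.le hc₀'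
    linarith
  have hxR : ‖x‖ ≤ R := by linarith [norm_nonneg y]
  have hyR : ‖y‖ ≤ R := by linarith [norm_nonneg x]
  have hsmall : (2 * a + β) * s ≤ η / 2 := by
    have : 0 ≤ (2 * a + β) * s := by positivity
    nlinarith
  have hrη : r ≤ η / 2 := by nlinarith [norm_nonneg x₀, norm_nonneg y₀]
  have hshift : ‖a • ((x - sU x) - (y - sV y))‖ ≤ 2 * a * s := by
    rw [norm_smul, Real.norm_eq_abs, abs_of_nonneg ha]
    nlinarith [norm_sub_le (x - sU x) (y - sV y)]
  have hβx : ‖β • (x - sU x)‖ ≤ β * s := by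
    rw [norm_smul, Real.norm_eq_abs, abs_of_pos hβ]
    gcongr
  have hβy : ‖β • (y - sV y)‖ ≤ β * s := by
    rw [norm_smul, Real.norm_eq_abs, abs_of_pos hβ]
    gcongr
  refine ⟨sU x, sV y, P, -Q, A₁ + (a + β) • I + η • I, -(A₂ + (a + β) • I + η • I),
    ?_, ?_, ?_, ?_, ?_, fun ξ ζ => ?_⟩
  · refine isLocalMax_sub_quadTest ?_
    filter_upwards [hUexp (η / 2) (half_pos hη)] with h hh
    have h1 := hU₂ (x + h) (sU x + h)
    rw [add_sub_add_right_eq_sub] at h1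
    rw [hI]
    linarith [(abs_le.1 hh).2, hU₁ x]
  · have hmax : IsLocalMax (fun z => -v z - quadTest (sV y) Q (A₂ + (a + β) • I + η • I) z)
        (sV y) := by
      refine isLocalMax_sub_quadTest ?_
      filter_upwards [hVexp (η / 2) (half_pos hη)] with h hh
      have h1 := hV₂ (y + h) (sV y + h)
      rw [add_sub_add_right_eq_sub] at h1
      rw [hI]
      linarith [(abs_le.1 hh).2, hV₁ y]
    have hneg : ∀ z, v z - quadTest (sV y) (-Q) (-(A₂ + (a + β) • I + η • I)) z =
        -(-v z - quadTest (sV y) Q (A₂ + (a + β) • I + η • I) z) := fun z => by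
      simp only [quadTest, inner_neg_left, _root_.neg_apply]
      ring
    simp only [hneg]
    exact hmax.neg
  · have h1 := doublingPenalty_add a β x y (sU x - x) (sV y - y)
    rw [add_sub_cancel, add_sub_cancel] at h1
    have h2 := doublingPenalty_le (β := β) ha (sU x - x) (sV y - y)
    rw [norm_sub_rev] at hxs hys
    have h3 : ‖a • (x - y) + β • x‖ ≤ (2 * a + β) * R := by
      refine (norm_add_le _ _).trans ?_
      rw [norm_smul, norm_smul, Real.norm_eq_abs, Real.norm_eq_abs, abs_of_nonneg ha,
        abs_of_pos hβ]
      nlinarith [norm_sub_le x y, norm_nonneg (x - y)]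
    have h4 : ‖-(a • (x - y)) + β • y‖ ≤ (2 * a + β) * R := by
      refine (norm_add_le _ _).trans ?_
      rw [norm_neg, norm_smul, norm_smul, Real.norm_eq_abs, Real.norm_eq_abs, abs_of_nonneg ha,
        abs_of_pos hβ]
      nlinarith [norm_sub_le x y, norm_nonneg (x - y)]
    have hRs : 0 ≤ (2 * a + β) * R := by positivity
    have h5 := (real_inner_le_norm (a • (x - y) + β • x) (sU x - x)).trans
      (mul_le_mul h3 hxs (norm_nonneg _) hRs)
    have h6 := (real_inner_le_norm (-(a • (x - y)) + β • y) (sV y - y)).trans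
      (mul_le_mul h4 hys (norm_nonneg _) hRs)
    have h7 : ‖sU x - x‖ ^ 2 ≤ s := by nlinarith [norm_nonneg (sU x - x)]
    have h8 : ‖sV y - y‖ ^ 2 ≤ s := by nlinarith [norm_nonneg (sV y - y)]
    have h9 : (2 * a + β) / 2 * (‖sU x - x‖ ^ 2 + ‖sV y - y‖ ^ 2) ≤ (2 * a + β) / 2 * (s + s) := by
      gcongr
    have h10 : 0 ≤ k / 2 * ‖x - sU x‖ ^ 2 := by positivity
    have h11 : 0 ≤ k / 2 * ‖y - sV y‖ ^ 2 := by positivity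
    have h12 : r * (‖x₀‖ + ‖x‖) + r * (‖y₀‖ + ‖y‖) ≤ r * (‖x₀‖ + ‖y₀‖ + 2 * R) := by
      rw [← mul_add]
      exact mul_le_mul_of_nonneg_left (by linarith) hr0.le
    linarith [hU₃ x₀, hV₃ y₀, hU₁ x, hV₁ y]
  · rw [show P - (a • (sU x - sV y) + β • sU x) =
      p + (a • ((x - sU x) - (y - sV y)) + β • (x - sU x)) by rw [hP]; module]
    have := norm_add_le p (a • ((x - sU x) - (y - sV y)) + β • (x - sU x))
    have := norm_add_le (a • ((x - sU x) - (y - sV y))) (β • (x - sU x))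
    linarith
  · rw [show -Q - (a • (sU x - sV y) - β • sV y) =
      (a • ((x - sU x) - (y - sV y)) - β • (y - sV y)) - q by rw [hQ]; module]
    have := norm_sub_le (a • ((x - sU x) - (y - sV y)) - β • (y - sV y)) q
    have := norm_sub_le (a • ((x - sU x) - (y - sV y))) (β • (y - sV y))
    linarith
  · have h1 := hhess ξ ζ
    rw [_root_.neg_apply, inner_neg_left, hI _ η, hI _ η]
    unfold doublingPenalty at h1
    linarith

end SemiconvexFunctions

section QuadTest

variable {H : Type*} [NormedAddCommGroup H] [InnerProductSpace ℝ H]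

/-- The second derivative of `quadTest x P A`, as a continuous bilinear map. -/
def quadTestHessian (A : H →L[ℝ] H) : H →L[ℝ] H →L[ℝ] ℝ :=
  (1 / 2 : ℝ) • ((innerSL ℝ).comp A + ((ContinuousLinearMap.compL ℝ H H ℝ).flip A).comp (innerSL ℝ))

lemma quadTestHessian_apply (A : H →L[ℝ] H) (h k : H) :
    quadTestHessian A h k = 1 / 2 * (⟪A h, k⟫ + ⟪A k, h⟫) := by
  rw [real_inner_comm h (A k)]
  rfl

lemma hasFDerivAt_quadTest (x P : H) (A : H →L[ℝ] H) (y : H) :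
    HasFDerivAt (quadTest x P A) (innerSL ℝ P + quadTestHessian A (y - x)) y := by
  have h1 : HasFDerivAt (fun y => y - x) (ContinuousLinearMap.id ℝ H) y :=
    (hasFDerivAt_id y).sub_const x
  have h2 := ((innerSL ℝ P).hasFDerivAt.comp y h1).add
    (((A.hasFDerivAt.comp y h1).inner ℝ h1).const_mul (1 / 2))
  refine h2.congr_fderiv ?_
  ext h
  simp only [_root_.add_apply, quadTestHessian_apply]
  simp [fderivInnerCLM_apply, real_inner_comm]

lemma fderiv_quadTest (x P : H) (A : H →L[ℝ] H) :
    fderiv ℝ (quadTest x P A) = fun y => innerSL ℝ P + quadTestHessian A (y - x) :=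
  funext fun y => (hasFDerivAt_quadTest x P A y).fderiv

lemma contDiff_quadTest (x P : H) (A : H →L[ℝ] H) {n : WithTop ℕ∞} :
    ContDiff ℝ n (quadTest x P A) := by
  have h1 : ContDiff ℝ n fun y => y - x := contDiff_id.sub contDiff_const
  exact (contDiff_const.inner ℝ h1).add (contDiff_const.mul ((A.contDiff.comp h1).inner ℝ h1))

lemma gradient_quadTest [CompleteSpace H] (x P : H) (A : H →L[ℝ] H) :
    gradient (quadTest x P A) x = P := by
  refine HasGradientAt.gradient ?_
  rw [hasGradientAt_iff_hasFDerivAt]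
  refine (hasFDerivAt_quadTest x P A x).congr_fderiv ?_
  ext h
  simp

end QuadTest

lemma hess_quadTest_apply (x P : E d) (A : E d →L[ℝ] E d) (i j : Fin d) :
    hess (quadTest x P A) x i j = 1 / 2 *
      (⟪A (EuclideanSpace.single i 1), EuclideanSpace.single j 1⟫ +
        ⟪A (EuclideanSpace.single j 1), EuclideanSpace.single i 1⟫) := by
  have h : HasFDerivAt (fderiv ℝ (quadTest x P A)) (quadTestHessian A) x := by
    rw [fderiv_quadTest]
    exact (((quadTestHessian A).hasFDerivAt.comp x ((hasFDerivAt_id x).sub_const x))).const_add _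
  rw [hess, Matrix.of_apply, iteratedFDeriv_two_apply, h.fderiv]
  exact quadTestHessian_apply A _ _

/-- The `k`-th column of a matrix as a Euclidean vector. -/
def colVec (S : Matrix (Fin d) (Fin d') ℝ) (k : Fin d') : E d := WithLp.toLp 2 fun i => S i k

lemma colVec_sub (S T : Matrix (Fin d) (Fin d') ℝ) (k : Fin d') :
    colVec (S - T) k = colVec S k - colVec T k := rfl

lemma colVec_eq_sum (S : Matrix (Fin d) (Fin d') ℝ) (k : Fin d') :
    colVec S k = ∑ i, S i k • EuclideanSpace.single i (1 : ℝ) := by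
  ext j
  simp [colVec, Pi.single_apply]

lemma sum_norm_colVec_sq (S : Matrix (Fin d) (Fin d') ℝ) :
    ∑ k, ‖colVec S k‖ ^ 2 = frobNorm S ^ 2 := by
  rw [frobNorm, Real.sq_sqrt (by positivity), Finset.sum_comm]
  exact Finset.sum_congr rfl fun k _ => by simp [EuclideanSpace.norm_sq_eq, colVec]

lemma inner_map_colVec (S : Matrix (Fin d) (Fin d') ℝ) (A : E d →L[ℝ] E d) (k : Fin d') :
    ⟪A (colVec S k), colVec S k⟫ = ∑ i, ∑ j, S i k * S j k *
      ⟪A (EuclideanSpace.single i 1), EuclideanSpace.single j (1 : ℝ)⟫ := by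
  rw [colVec_eq_sum, map_sum, sum_inner]
  refine Finset.sum_congr rfl fun i _ => ?_
  rw [inner_sum]
  refine Finset.sum_congr rfl fun j _ => ?_
  rw [map_smul, real_inner_smul_left, real_inner_smul_right]
  ring

lemma trace_mul_hess_quadTest (S : Matrix (Fin d) (Fin d') ℝ) (x P : E d) (A : E d →L[ℝ] E d) :
    Matrix.trace (((1 : ℝ) / 2) • (S * Sᵀ) * hess (quadTest x P A) x) =
      1 / 2 * ∑ k, ⟪A (colVec S k), colVec S k⟫ := by
  set a : Fin d → Fin d → ℝ := fun i j =>
    ⟪A (EuclideanSpace.single i 1), EuclideanSpace.single j (1 : ℝ)⟫ with ha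
  have hsymm : ∑ i, ∑ j, (∑ k, S i k * S j k) * a j i = ∑ i, ∑ j, (∑ k, S i k * S j k) * a i j := by
    rw [Finset.sum_comm]
    refine Finset.sum_congr rfl fun j _ => Finset.sum_congr rfl fun i _ => ?_
    rw [Finset.sum_congr rfl fun k _ => mul_comm (S i k) (S j k)]
  have hcol : ∑ k, ⟪A (colVec S k), colVec S k⟫ = ∑ i, ∑ j, (∑ k, S i k * S j k) * a i j := by
    simp only [inner_map_colVec]
    rw [Finset.sum_comm]
    refine Finset.sum_congr rfl fun i _ => ?_
    rw [Finset.sum_comm]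
    exact Finset.sum_congr rfl fun j _ => by rw [Finset.sum_mul]
  have htrace : Matrix.trace ((S * Sᵀ) * hess (quadTest x P A) x) =
      1 / 2 * (∑ i, ∑ j, (∑ k, S i k * S j k) * a j i +
        ∑ i, ∑ j, (∑ k, S i k * S j k) * a i j) := by
    simp only [Matrix.trace, Matrix.diag_apply, Matrix.mul_apply, Matrix.transpose_apply,
      hess_quadTest_apply]
    rw [← Finset.sum_add_distrib, Finset.mul_sum]
    refine Finset.sum_congr rfl fun i _ => ?_
    rw [← Finset.sum_add_distrib, Finset.mul_sum]
    exact Finset.sum_congr rfl fun j _ => by rw [ha]; ring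
  rw [Matrix.smul_mul, Matrix.trace_smul, htrace, hsymm, hcol, smul_eq_mul]
  ring

/-- The linear operator `L^α_i(x, s, p, A)`, with the second-order argument given as an operator. -/
def HJBData.jetL (P : HJBData d d' M 𝒜) (i : Fin M) (α : 𝒜) (x : E d) (s : Fin M → ℝ) (p : E d)
    (A : E d →L[ℝ] E d) : ℝ :=
  -(1 / 2 * ∑ k, ⟪A (colVec (P.σm i α x) k), colVec (P.σm i α x) k⟫)
  - ⟪P.bv i α x, p⟫ + P.cz i α x * s i - P.runCost i α x
  - ∑ j ∈ Finset.univ.erase i, P.dcp i j α x * s j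

/-- `sup_{α ∈ A_i} L^α_i ≤ 0`. -/
def HJBData.JetNonpos (P : HJBData d d' M 𝒜) (i : Fin M) (x : E d) (s : Fin M → ℝ) (p : E d)
    (A : E d →L[ℝ] E d) : Prop :=
  ∀ α ∈ P.A i, P.jetL i α x s p A ≤ 0

/-- `0 ≤ sup_{α ∈ A_i} L^α_i`. -/
def HJBData.JetNonneg (P : HJBData d d' M 𝒜) (i : Fin M) (x : E d) (s : Fin M → ℝ) (p : E d)
    (A : E d →L[ℝ] E d) : Prop :=
  ∀ τ > 0, ∃ α ∈ P.A i, -τ ≤ P.jetL i α x s p A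

lemma HJBData.L_quadTest (P : HJBData d d' M 𝒜) (i : Fin M) (α : 𝒜) (x : E d) (s : Fin M → ℝ)
    (p : E d) (A : E d →L[ℝ] E d) :
    P.L i α x s (gradient (quadTest x p A) x) (hess (quadTest x p A) x) =
      P.jetL i α x s p A := by
  rw [HJBData.L, trace_mul_hess_quadTest, gradient_quadTest, HJBData.jetL]

lemma sum_inner_colVec_le {S : Matrix (Fin d) (Fin d') ℝ} {C : ℝ} (hS : frobNorm S ≤ C)
    (A : E d →L[ℝ] E d) : |∑ k, ⟪A (colVec S k), colVec S k⟫| ≤ ‖A‖ * C ^ 2 := by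
  have hS0 : 0 ≤ frobNorm S := Real.sqrt_nonneg _
  calc |∑ k, ⟪A (colVec S k), colVec S k⟫| ≤ ∑ k, ‖A‖ * ‖colVec S k‖ ^ 2 := by
        refine (Finset.abs_sum_le_sum_abs _ _).trans (Finset.sum_le_sum fun k _ => ?_)
        refine (abs_real_inner_le_norm _ _).trans ?_
        rw [sq, ← mul_assoc]
        gcongr
        exact A.le_opNorm _
    _ = ‖A‖ * frobNorm S ^ 2 := by rw [← Finset.mul_sum, sum_norm_colVec_sq]
    _ ≤ ‖A‖ * C ^ 2 := by gcongr

lemma H1.bddAbove_jetL {P : HJBData d d' M 𝒜} {C lam0 : ℝ} (h1 : H1 P C lam0) (i : Fin M)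
    (x : E d) (s : Fin M → ℝ) (p : E d) (A : E d →L[ℝ] E d) :
    BddAbove ((fun α => P.jetL i α x s p A) '' P.A i) := by
  refine ⟨1 / 2 * (‖A‖ * C ^ 2) + C * ‖p‖ + C * |s i| + C +
    ∑ j ∈ Finset.univ.erase i, C * |s j|, ?_⟩
  rintro _ ⟨α, hα, rfl⟩
  obtain ⟨-, -, -, -, -, hσ, -, hb, -, hc, -, hl, -, hd, -, -⟩ := h1.2.2 i α hα
  have e1 := (abs_le.1 (sum_inner_colVec_le (hσ x) A)).1
  have e2 : -(C * ‖p‖) ≤ ⟪P.bv i α x, p⟫ := by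
    have := (abs_real_inner_le_norm (P.bv i α x) p).trans
      (mul_le_mul_of_nonneg_right (hb x) (norm_nonneg p))
    exact (abs_le.1 this).1
  have e3 : P.cz i α x * s i ≤ C * |s i| := (le_abs_self _).trans <| by
    rw [abs_mul]
    exact mul_le_mul_of_nonneg_right (hc x) (abs_nonneg _)
  have e4 := (abs_le.1 (hl x)).1
  have e5 : -∑ j ∈ Finset.univ.erase i, P.dcp i j α x * s j ≤
      ∑ j ∈ Finset.univ.erase i, C * |s j| := by
    rw [← Finset.sum_neg_distrib]
    refine Finset.sum_le_sum fun j _ => (neg_le_abs _).trans ?_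
    rw [abs_mul]
    exact mul_le_mul_of_nonneg_right ((hd j).1 x) (abs_nonneg _)
  simp only [HJBData.jetL]
  linarith

lemma H1.jetNonpos {P : HJBData d d' M 𝒜} {C lam0 : ℝ} (h1 : H1 P C lam0) {i : Fin M}
    {x : E d} {s : Fin M → ℝ} {p : E d} {A : E d →L[ℝ] E d}
    (h : P.Ham i x s (gradient (quadTest x p A) x) (hess (quadTest x p A) x) ≤ 0) :
    P.JetNonpos i x s p A := fun α hα => by
  simp only [HJBData.Ham, HJBData.L_quadTest] at h
  exact (le_csSup (h1.bddAbove_jetL i x s p A) ⟨α, hα, rfl⟩).trans h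

lemma H1.jetNonneg {P : HJBData d d' M 𝒜} {C lam0 : ℝ} (h1 : H1 P C lam0) {i : Fin M}
    {x : E d} {s : Fin M → ℝ} {p : E d} {A : E d →L[ℝ] E d}
    (h : 0 ≤ P.Ham i x s (gradient (quadTest x p A) x) (hess (quadTest x p A) x)) :
    P.JetNonneg i x s p A := fun τ hτ => by
  simp only [HJBData.Ham, HJBData.L_quadTest] at h
  obtain ⟨_, ⟨α, hα, rfl⟩, hlt⟩ := exists_lt_of_lt_csSup ((h1.2.1 i).1.image _)
    ((neg_neg_of_pos hτ).trans_le h)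
  exact ⟨α, hα, hlt.le⟩

/-- The structure condition behind the comparison principle. -/
lemma H1.mul_sub_le_of_doubling {P : HJBData d d' M 𝒜} {C lam0 : ℝ} (h1 : H1 P C lam0) {i : Fin M}
    {α : 𝒜} (hα : α ∈ P.A i) {x y p q : E d} {s t : Fin M → ℝ} {A₁ A₂ : E d →L[ℝ] E d}
    {a β η θ τ B : ℝ} (ha : 0 ≤ a) (hβ : 0 ≤ β) (hη : 0 ≤ η) (hθ : 0 ≤ θ) (hst0 : 0 ≤ s i - t i)
    (hst : ∀ j, s j - t j ≤ s i - t i + θ) (htB : ∀ j, |t j| ≤ B)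
    (hp : ‖p - (a • (x - y) + β • x)‖ ≤ η) (hq : ‖q - (a • (x - y) - β • y)‖ ≤ η)
    (hA : ∀ ξ ζ, ⟪A₁ ξ, ξ⟫ - ⟪A₂ ζ, ζ⟫ ≤ a * ‖ξ - ζ‖ ^ 2 + (β + η) * (‖ξ‖ ^ 2 + ‖ζ‖ ^ 2))
    (hs : P.jetL i α x s p A₁ ≤ 0) (ht : -τ ≤ P.jetL i α y t q A₂) :
    lam0 * (s i - t i) ≤ τ + (C ^ 2 + C) * (a * ‖x - y‖ ^ 2) + (β + η) * C ^ 2 +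
      C * (β * (‖x‖ + ‖y‖)) + 2 * C * η + C * ((M + 1) * B + 1) * ‖x - y‖ + M * C * θ := by
  obtain ⟨-, -, -, -, -, hσ, hσL, hb, hbL, hc, hcL, hl, hlL, hd, hd0, hlam⟩ := h1.2.2 i α hα
  have hC : 0 ≤ C := (norm_nonneg _).trans (hb x)
  set D := ‖x - y‖ with hD
  have hD0 : 0 ≤ D := norm_nonneg _
  have hsq : ∀ {r : ℝ} {S : Matrix (Fin d) (Fin d') ℝ}, frobNorm S ≤ r →
      ∑ k, ‖colVec S k‖ ^ 2 ≤ r ^ 2 := fun {r S} hS => by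
    rw [sum_norm_colVec_sq]
    exact pow_le_pow_left₀ (Real.sqrt_nonneg _) hS 2
  have e1 : ∑ k, ⟪A₁ (colVec (P.σm i α x) k), colVec (P.σm i α x) k⟫ -
      ∑ k, ⟪A₂ (colVec (P.σm i α y) k), colVec (P.σm i α y) k⟫ ≤
      a * (C * D) ^ 2 + (β + η) * (C ^ 2 + C ^ 2) := by
    have hx := hsq (hσ x)
    have hy := hsq (hσ y)
    have hxy := hsq (hσL x y)
    rw [← Finset.sum_sub_distrib]
    refine (Finset.sum_le_sum fun k _ => hA _ _).trans ?_
    rw [Finset.sum_add_distrib, ← Finset.mul_sum, ← Finset.mul_sum, Finset.sum_add_distrib]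
    simp only [← colVec_sub]
    gcongr
  have e2 : ⟪P.bv i α x, p⟫ - ⟪P.bv i α y, q⟫ ≤ 2 * C * η + C * (a * D ^ 2) +
      C * (β * (‖x‖ + ‖y‖)) := by
    have hin : ∀ {v w : E d} {m : ℝ}, ‖w‖ ≤ m → ‖v‖ ≤ C → |⟪v, w⟫| ≤ C * m := fun hw hv =>
      (abs_real_inner_le_norm _ _).trans (mul_le_mul hv hw (norm_nonneg _) hC)
    have f1 := (abs_le.1 (hin hp (hb x))).2
    have f2 := (abs_le.1 (hin hq (hb y))).1
    have f3 := (abs_le.1 (hin le_rfl (hb x) : |⟪P.bv i α x, x⟫| ≤ C * ‖x‖)).2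
    have f4 := (abs_le.1 (hin le_rfl (hb y) : |⟪P.bv i α y, y⟫| ≤ C * ‖y‖)).2
    have f5 : ⟪P.bv i α x - P.bv i α y, x - y⟫ ≤ C * D * D :=
      (real_inner_le_norm _ _).trans (mul_le_mul_of_nonneg_right (hbL x y) (norm_nonneg _))
    have f6 := mul_le_mul_of_nonneg_left f3 hβ
    have f7 := mul_le_mul_of_nonneg_left f4 hβ
    have f8 := mul_le_mul_of_nonneg_left f5 ha
    rw [inner_sub_left] at f8
    simp only [inner_sub_right, inner_add_right, real_inner_smul_right] at f1 f2 f8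
    linarith
  have hBt := fun j => mul_le_mul (hcL y x) (htB j) (abs_nonneg _)
    (mul_nonneg hC (norm_nonneg (y - x)))
  have e3 : P.cz i α y * t i - P.cz i α x * s i ≤ -(P.cz i α x * (s i - t i)) + C * D * B := by
    have := (le_abs_self _).trans (((abs_mul _ _).le).trans (hBt i))
    rw [norm_sub_rev] at this
    linarith
  have e4 : P.runCost i α x - P.runCost i α y ≤ C * D := (le_abs_self _).trans (hlL x y)
  have e5 : ∑ j ∈ Finset.univ.erase i, P.dcp i j α x * s j -
      ∑ j ∈ Finset.univ.erase i, P.dcp i j α y * t j ≤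
      (∑ j ∈ Finset.univ.erase i, P.dcp i j α x) * (s i - t i) + M * (C * θ + C * D * B) := by
    have hB0 : 0 ≤ B := (abs_nonneg _).trans (htB i)
    have hterm : ∀ j ∈ Finset.univ.erase i, P.dcp i j α x * s j - P.dcp i j α y * t j ≤
        P.dcp i j α x * (s i - t i) + (C * θ + C * D * B) := fun j hj => by
      have g1 := mul_le_mul_of_nonneg_left (hst j) (hd0 j hj x)
      have g2 := mul_le_mul_of_nonneg_right ((le_abs_self _).trans ((hd j).1 x)) hθ
      have g3 := (le_abs_self _).trans (((abs_mul _ _).le).trans (mul_le_mul ((hd j).2 x y) (htB j)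
        (abs_nonneg _) (mul_nonneg hC (norm_nonneg (x - y)))))
      linarith
    rw [← Finset.sum_sub_distrib]
    refine (Finset.sum_le_sum hterm).trans ?_
    rw [Finset.sum_add_distrib, Finset.sum_mul, Finset.sum_const, nsmul_eq_mul]
    gcongr
    simp
  have e6 := mul_le_mul_of_nonneg_right (hlam x) hst0
  have e7 : 0 ≤ C ^ 2 * (a * D ^ 2) := by positivity
  simp only [HJBData.jetL] at hs ht
  linarith

/-- Doubling of variables with a large penalty: near-maximisers carrying quadratic test functions. -/
lemma exists_quadTest_doubling_system {ι H : Type*} [NormedAddCommGroup H] [InnerProductSpace ℝ H]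
    [FiniteDimensional ℝ H] {U V : ι → H → ℝ} (hU : ∀ i, Continuous (U i))
    (hV : ∀ i, Continuous (V i)) {B : ℝ} (hUB : ∀ i x, |U i x| ≤ B) (hVB : ∀ i x, |V i x| ≤ B)
    {β η ρ : ℝ} (hβ : 0 < β) (hη : 0 < η) (hρ : 0 < ρ) (i₀ : ι) (x₀ : H) :
    ∃ (a : ℝ) (i : ι) (x y p q : H) (A₁ A₂ : H →L[ℝ] H), 0 ≤ a ∧
      IsLocalMax (fun z => U i z - quadTest x p A₁ z) x ∧
      IsLocalMin (fun z => V i z - quadTest y q A₂ z) y ∧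
      ‖p - (a • (x - y) + β • x)‖ ≤ η ∧ ‖q - (a • (x - y) - β • y)‖ ≤ η ∧
      (∀ ξ ζ, ⟪A₁ ξ, ξ⟫ - ⟪A₂ ζ, ζ⟫ ≤ a * ‖ξ - ζ‖ ^ 2 + (β + η) * (‖ξ‖ ^ 2 + ‖ζ‖ ^ 2)) ∧
      a * ‖x - y‖ ^ 2 ≤ 12 * η ∧ ‖x - y‖ ≤ ρ ∧
      U i₀ x₀ - V i₀ x₀ - β * ‖x₀‖ ^ 2 + β / 2 * (‖x‖ ^ 2 + ‖y‖ ^ 2) ≤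
        U i x - V i y + 2 * η ∧
      ∀ j, U j x - V j y ≤ U i x - V i y + 2 * η := by
  set F : ℝ → ι × H × H → ℝ := fun a t =>
    U t.1 t.2.1 - V t.1 t.2.2 - doublingPenalty a β t.2.1 t.2.2 with hF
  have : Nonempty ι := ⟨i₀⟩
  have hbdd : ∀ a, 0 ≤ a → BddAbove (Set.range (F a)) := fun a ha => by
    refine ⟨2 * B, ?_⟩
    rintro _ ⟨⟨i, x, y⟩, rfl⟩
    have h1 := (abs_le.1 (hUB i x)).2
    have h2 := (abs_le.1 (hVB i y)).1
    have h3 := doublingPenalty_nonneg ha hβ.le x y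
    simp only [hF]
    linarith
  set m : ℕ → ℝ := fun k => ⨆ t, F (2 ^ k) t with hm
  have hle : ∀ k t, F (2 ^ k) t ≤ m k := fun k t => le_ciSup (hbdd _ (by positivity)) t
  have hm₀ : ∀ k, U i₀ x₀ - V i₀ x₀ - β * ‖x₀‖ ^ 2 ≤ m k := fun k => by
    have h := hle k (i₀, x₀, x₀)
    simp only [hF, doublingPenalty, sub_self, norm_zero] at h
    linarith
  have hsplit : ∀ k i x y, F (2 ^ k) (i, x, y) =
      F (2 ^ (k + 1)) (i, x, y) + 2 ^ (k + 1) / 4 * ‖x - y‖ ^ 2 := fun k i x y => by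
    simp only [hF, doublingPenalty, pow_succ]
    ring
  have hanti : Antitone m := antitone_nat_of_succ_le fun k => ciSup_le fun ⟨i, x, y⟩ => by
    have h1 := hle k (i, x, y)
    have h2 : (0 : ℝ) ≤ 2 ^ (k + 1) / 4 * ‖x - y‖ ^ 2 := by positivity
    rw [hsplit] at h1
    linarith
  have hconv : Tendsto m atTop (𝓝 (⨅ k, m k)) := tendsto_atTop_ciInf hanti
    ⟨_, by rintro _ ⟨k, rfl⟩; exact hm₀ k⟩
  have hdiff : Tendsto (fun k => m k - m (k + 1)) atTop (𝓝 0) := by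
    simpa using hconv.sub (hconv.comp (tendsto_add_atTop_nat 1))
  have hlarge : ∀ᶠ k : ℕ in atTop, 12 * η / ρ ^ 2 ≤ 2 ^ k :=
    (tendsto_pow_atTop_atTop_of_one_lt (one_lt_two : (1 : ℝ) < 2)).eventually_ge_atTop _
  obtain ⟨k, hk1, hk2⟩ := ((hdiff.eventually_le_const hη).and hlarge).exists
  obtain ⟨⟨i, x', y'⟩, hnear⟩ := exists_lt_of_lt_ciSup (sub_lt_self (m (k + 1)) hη)
  have ha : (0 : ℝ) ≤ 2 ^ (k + 1) := by positivity
  obtain ⟨x, y, p, q, A₁, A₂, hmax, hmin, hval, hp, hq, hA⟩ := exists_quadTest_of_doubling (hU i)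
    (hV i) (hUB i) (hVB i) ha hβ hη x' y'
  have hval' : m (k + 1) - 2 * η ≤ F (2 ^ (k + 1)) (i, x, y) := by
    simp only [hF] at hnear ⊢
    linarith
  have haD : 2 ^ (k + 1) * ‖x - y‖ ^ 2 ≤ 12 * η := by
    have h1 := hle k (i, x, y)
    rw [hsplit] at h1
    linarith
  have hsq : (2 : ℝ) ^ (k + 1) / 2 * ‖x - y‖ ^ 2 + β / 2 * (‖x‖ ^ 2 + ‖y‖ ^ 2) =
    doublingPenalty (2 ^ (k + 1)) β x y := rfl
  refine ⟨2 ^ (k + 1), i, x, y, p, q, A₁, A₂, ha, hmax, hmin, hp, hq, hA, haD, ?_, ?_, fun j => ?_⟩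
  · refine abs_le_of_sq_le_sq' ?_ hρ.le |>.2
    rw [div_le_iff₀ (by positivity)] at hk2
    rw [pow_succ] at haD
    have h2 : (0 : ℝ) < 2 ^ k := by positivity
    have h3 : 2 ^ k * ‖x - y‖ ^ 2 ≤ 2 ^ k * ρ ^ 2 := by
      have : (0 : ℝ) ≤ 2 ^ k * ‖x - y‖ ^ 2 := by positivity
      linarith
    exact le_of_mul_le_mul_left h3 h2
  · have h1 := hm₀ (k + 1)
    have h2 : (0 : ℝ) ≤ 2 ^ (k + 1) / 2 * ‖x - y‖ ^ 2 := by positivity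
    simp only [hF] at hval'
    linarith
  · have h1 := hle (k + 1) (j, x, y)
    simp only [hF] at hval' h1
    linarith

lemma exists_pos_le_one_mul_le (c : ℝ) {e : ℝ} (he : 0 < e) :
    ∃ r : ℝ, 0 < r ∧ r ≤ 1 ∧ c * r ≤ e := by
  have hc : 0 < |c| + 1 := by positivity
  refine ⟨min 1 (e / (|c| + 1)), by positivity, min_le_left _ _, ?_⟩
  have h1 : min 1 (e / (|c| + 1)) * (|c| + 1) ≤ e := by
    rw [← le_div_iff₀ hc]
    exact min_le_right _ _
  have h2 : 0 ≤ min 1 (e / (|c| + 1)) := by positivity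
  nlinarith [mul_le_mul_of_nonneg_right (le_abs_self c) h2]

set_option maxHeartbeats 1000000 in
/-- **Comparison principle** for the obstacle problem, in terms of quadratic test functions. -/
theorem H1.le_of_jets {P : HJBData d d' M 𝒜} {C lam0 : ℝ} (h1 : H1 P C lam0)
    {U V Ψ : Fin M → E d → ℝ} (hUc : ∀ i, Continuous (U i)) (hVc : ∀ i, Continuous (V i))
    (hΨc : ∀ i, Continuous (Ψ i)) {B : ℝ} (hUB : ∀ i x, |U i x| ≤ B) (hVB : ∀ i x, |V i x| ≤ B)
    (hU : ∀ i x p A, IsLocalMax (fun z => U i z - quadTest x p A z) x →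
      P.JetNonpos i x (fun j => U j x) p A ∧ U i x ≤ Ψ i x)
    (hV : ∀ i x p A, IsLocalMin (fun z => V i z - quadTest x p A z) x →
      P.JetNonneg i x (fun j => V j x) p A ∨ Ψ i x ≤ V i x) (i₀ : Fin M) (x₀ : E d) :
    U i₀ x₀ ≤ V i₀ x₀ := by
  by_contra! hlt
  obtain ⟨s, hs0, hs⟩ : ∃ s, 0 < s ∧ 3 * s = U i₀ x₀ - V i₀ x₀ :=
    ⟨(U i₀ x₀ - V i₀ x₀) / 3, by linarith, by ring⟩
  have hlam := h1.1
  have hB0 : 0 ≤ B := (abs_nonneg _).trans (hUB i₀ x₀)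
  have hC : 0 ≤ C := by
    obtain ⟨α, hα⟩ := (h1.2.1 i₀).1
    obtain ⟨-, -, -, -, -, -, -, hb, -⟩ := h1.2.2 i₀ α hα
    exact (norm_nonneg _).trans (hb 0)
  have he : 0 < lam0 * s / 8 := by positivity
  set T := 4 * B + 4 with hT
  obtain ⟨κ₁, hκ₁0, hκ₁1, hκ₁⟩ := exists_pos_le_one_mul_le (‖x₀‖ ^ 2) hs0
  obtain ⟨κ₂, hκ₂0, hκ₂1, hκ₂⟩ := exists_pos_le_one_mul_le (C ^ 2 + 2 * C * (T + 1)) he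
  obtain ⟨η₁, hη₁0, hη₁1, hη₁⟩ := exists_pos_le_one_mul_le
    (12 * (C ^ 2 + C) + C ^ 2 + 2 * C + 2 * M * C) he
  obtain ⟨ρ₁, hρ₁0, hρ₁1, hρ₁⟩ := exists_pos_le_one_mul_le (C * ((M + 1) * B + 1)) he
  set κ := min κ₁ κ₂ with hκ
  have hκ0 : 0 < κ := lt_min hκ₁0 hκ₂0
  have hκ1 : κ ≤ 1 := (min_le_left _ _).trans hκ₁1
  set η := min η₁ (s / 2) with hη
  have hη0 : 0 < η := lt_min hη₁0 (half_pos hs0)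
  have hη1 : η ≤ 1 := (min_le_left _ _).trans hη₁1
  have hηs : η ≤ s / 2 := min_le_right _ _
  obtain ⟨δ, hδ0, hδ⟩ : ∃ δ > 0, ∀ x y : E d, ‖x‖ ≤ (T + 1) / κ → ‖y‖ ≤ (T + 1) / κ →
      ‖x - y‖ < δ → ∀ i, |Ψ i x - Ψ i y| < s := by
    have hcont : Continuous fun x i => Ψ i x := continuous_pi hΨc
    obtain ⟨δ, hδ0, hδ⟩ := Metric.uniformContinuousOn_iff.1
      ((isCompact_closedBall (0 : E d) ((T + 1) / κ)).uniformContinuousOn_of_continuous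
        hcont.continuousOn) s hs0
    refine ⟨δ, hδ0, fun x y hx hy hxy i => ?_⟩
    have := hδ x (by simpa using hx) y (by simpa using hy) (by rwa [dist_eq_norm])
    exact (dist_le_pi_dist _ _ i).trans_lt this
  obtain ⟨a, i, x, y, p, q, A₁, A₂, ha, hmax, hmin, hp, hq, hA, haD, hD, hG, hGj⟩ :=
    exists_quadTest_doubling_system hUc hVc hUB hVB (pow_pos hκ0 2) hη0
      (lt_min hρ₁0 (half_pos hδ0)) i₀ x₀
  have hκx₀ : κ ^ 2 * ‖x₀‖ ^ 2 ≤ s := by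
    have h2 : κ ^ 2 ≤ κ₁ := by nlinarith [min_le_left κ₁ κ₂]
    nlinarith [mul_le_mul_of_nonneg_right h2 (sq_nonneg ‖x₀‖)]
  have hpos : 0 ≤ κ ^ 2 / 2 * (‖x‖ ^ 2 + ‖y‖ ^ 2) := by positivity
  have hGs : s ≤ U i x - V i y := by linarith
  have hquad : κ ^ 2 * (‖x‖ ^ 2 + ‖y‖ ^ 2) ≤ T := by
    have h2 := (abs_le.1 (hUB i x)).2
    have h3 := (abs_le.1 (hVB i y)).1
    linarith
  have hroot : ∀ n : ℝ, 0 ≤ n → κ ^ 2 * n ^ 2 ≤ T → κ * n ≤ T + 1 := fun n hn h => by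
    refine abs_le_of_sq_le_sq' ?_ (by positivity) |>.2
    nlinarith
  have hx : κ * ‖x‖ ≤ T + 1 := hroot _ (norm_nonneg _) <| by
    nlinarith [mul_nonneg (sq_nonneg κ) (sq_nonneg ‖y‖)]
  have hy : κ * ‖y‖ ≤ T + 1 := hroot _ (norm_nonneg _) <| by
    nlinarith [mul_nonneg (sq_nonneg κ) (sq_nonneg ‖x‖)]
  obtain ⟨hjU, hUΨ⟩ := hU i x p A₁ hmax
  rcases hV i y q A₂ hmin with hjV | hΨV
  · obtain ⟨α, hα, ht⟩ := hjV _ he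
    have hmain := h1.mul_sub_le_of_doubling hα (s := fun j => U j x) (t := fun j => V j y) ha
      (sq_nonneg κ) hη0.le (mul_nonneg zero_le_two hη0.le) (by linarith) hGj (fun j => hVB j y)
      hp hq hA (hjU α hα) ht
    have h2 := mul_le_mul_of_nonneg_left hGs hlam.le
    have h3 := mul_le_mul_of_nonneg_left haD (by positivity : 0 ≤ C ^ 2 + C)
    have h4 : (12 * (C ^ 2 + C) + C ^ 2 + 2 * C + 2 * M * C) * η ≤ lam0 * s / 8 :=
      (mul_le_mul_of_nonneg_left (min_le_left _ _) (by positivity)).trans hη₁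
    have h5 : C * ((M + 1) * B + 1) * ‖x - y‖ ≤ lam0 * s / 8 :=
      (mul_le_mul_of_nonneg_left (hD.trans (min_le_left _ _)) (by positivity)).trans hρ₁
    have h6 : (C ^ 2 + 2 * C * (T + 1)) * κ ≤ lam0 * s / 8 :=
      (mul_le_mul_of_nonneg_left (min_le_right _ _) (by positivity)).trans hκ₂
    have h7 : κ ^ 2 * C ^ 2 ≤ κ * C ^ 2 := by gcongr; nlinarith
    have h8 : C * (κ ^ 2 * (‖x‖ + ‖y‖)) ≤ C * κ * (2 * (T + 1)) := by
      have : 0 ≤ C * κ := by positivity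
      nlinarith [mul_le_mul_of_nonneg_left (add_le_add hx hy) this]
    linarith
  · have h2 := hδ x y (by rwa [le_div_iff₀' hκ0]) (by rwa [le_div_iff₀' hκ0])
      ((hD.trans (min_le_right _ _)).trans_lt (half_lt_self hδ0)) i
    have h3 := (le_abs_self _).trans_lt h2
    linarith

lemma H1.le_of_jets_of_bdd {P : HJBData d d' M 𝒜} {C lam0 : ℝ} (h1 : H1 P C lam0)
    {U V Ψ : Fin M → E d → ℝ} (hUc : ∀ i, Continuous (U i)) (hVc : ∀ i, Continuous (V i))
    (hΨc : ∀ i, Continuous (Ψ i)) (hUB : Bdd U) (hVB : Bdd V)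
    (hU : ∀ i x p A, IsLocalMax (fun z => U i z - quadTest x p A z) x →
      P.JetNonpos i x (fun j => U j x) p A ∧ U i x ≤ Ψ i x)
    (hV : ∀ i x p A, IsLocalMin (fun z => V i z - quadTest x p A z) x →
      P.JetNonneg i x (fun j => V j x) p A ∨ Ψ i x ≤ V i x) (i : Fin M) (x : E d) :
    U i x ≤ V i x := by
  obtain ⟨B₁, hB₁⟩ := hUB
  obtain ⟨B₂, hB₂⟩ := hVB
  exact h1.le_of_jets hUc hVc hΨc (fun i x => (hB₁ i x).trans (le_max_left B₁ B₂))
    (fun i x => (hB₂ i x).trans (le_max_right B₁ B₂)) hU hV i x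

lemma IsSubsolution.jets_hjb {P : HJBData d d' M 𝒜} {C lam0 : ℝ} {u : Fin M → E d → ℝ}
    (hu : IsSubsolution (Fhjb P) u) (h1 : H1 P C lam0) (i : Fin M) (x p : E d)
    (A : E d →L[ℝ] E d) (h : IsLocalMax (fun z => u i z - quadTest x p A z) x) :
    P.JetNonpos i x (fun j => u j x) p A :=
  h1.jetNonpos (hu.2 i _ (contDiff_quadTest x p A) x h)

lemma IsSupersolution.jets_hjb {P : HJBData d d' M 𝒜} {C lam0 : ℝ} {u : Fin M → E d → ℝ}
    (hu : IsSupersolution (Fhjb P) u) (h1 : H1 P C lam0) (i : Fin M) (x p : E d)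
    (A : E d →L[ℝ] E d) (h : IsLocalMin (fun z => u i z - quadTest x p A z) x) :
    P.JetNonneg i x (fun j => u j x) p A :=
  h1.jetNonneg (hu.2 i _ (contDiff_quadTest x p A) x h)

lemma IsSubsolution.jets_obstacle {P : HJBData d d' M 𝒜} {C lam0 : ℝ} {u Ψ : Fin M → E d → ℝ}
    (hu : IsSubsolution (Fob P Ψ) u) (h1 : H1 P C lam0) (i : Fin M) (x p : E d)
    (A : E d →L[ℝ] E d) (h : IsLocalMax (fun z => u i z - quadTest x p A z) x) :
    P.JetNonpos i x (fun j => u j x) p A ∧ u i x ≤ Ψ i x := by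
  obtain ⟨h2, h3⟩ := max_le_iff.1 (hu.2 i _ (contDiff_quadTest x p A) x h)
  exact ⟨h1.jetNonpos h2, sub_nonpos.1 h3⟩

lemma IsSupersolution.jets_obstacle {P : HJBData d d' M 𝒜} {C lam0 : ℝ} {u Ψ : Fin M → E d → ℝ}
    (hu : IsSupersolution (Fob P Ψ) u) (h1 : H1 P C lam0) (i : Fin M) (x p : E d)
    (A : E d →L[ℝ] E d) (h : IsLocalMin (fun z => u i z - quadTest x p A z) x) :
    P.JetNonneg i x (fun j => u j x) p A ∨ Ψ i x ≤ u i x :=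
  (le_max_iff.1 (hu.2 i _ (contDiff_quadTest x p A) x h)).imp h1.jetNonneg sub_nonneg.1

section Intervention

variable {Q : ImpulseData d M 𝒵} {κ₀ : ℝ}

lemma H2.continuous_cost (h2 : H2 Q κ₀) {u : Fin M → E d → ℝ} (hu : ∀ i, Continuous (u i))
    (i : Fin M) : Continuous fun t : E d × 𝒵 => u i (Q.Γ i t.1 t.2) + Q.K i t.1 t.2 :=
  ((hu i).comp (h2.2.2.1 i)).add (h2.2.2.2.1 i)

lemma H2.exists_Mop_eq (h2 : H2 Q κ₀) {u : Fin M → E d → ℝ} (hu : ∀ i, Continuous (u i))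
    (i : Fin M) (x : E d) :
    ∃ z ∈ Q.Z i x, Q.Mop i u x = u i (Q.Γ i x z) + Q.K i x z :=
  (h2.2.1 i x).2.exists_sInf_image_eq (h2.2.1 i x).1
    ((h2.continuous_cost hu i).comp (Continuous.prodMk_right x)).continuousOn

lemma H2.Mop_le (h2 : H2 Q κ₀) {u : Fin M → E d → ℝ} (hu : ∀ i, Continuous (u i))
    {i : Fin M} {x : E d} {z : 𝒵} (hz : z ∈ Q.Z i x) :
    Q.Mop i u x ≤ u i (Q.Γ i x z) + Q.K i x z :=
  csInf_le ((h2.2.1 i x).2.bddBelow_image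
    ((h2.continuous_cost hu i).comp (Continuous.prodMk_right x)).continuousOn) ⟨z, hz, rfl⟩

lemma H2.Mop_mono (h2 : H2 Q κ₀) {u v : Fin M → E d → ℝ} (hu : ∀ i, Continuous (u i))
    (hv : ∀ i, Continuous (v i)) (huv : ∀ i x, u i x ≤ v i x) (i : Fin M) (x : E d) :
    Q.Mop i u x ≤ Q.Mop i v x := by
  obtain ⟨z, hz, h⟩ := h2.exists_Mop_eq hv i x
  rw [h]
  exact (h2.Mop_le hu hz).trans (by gcongr; exact huv _ _)

lemma H2.continuous_Mop (h2 : H2 Q κ₀) {u : Fin M → E d → ℝ} (hu : ∀ i, Continuous (u i))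
    (i : Fin M) : Continuous fun x => Q.Mop i u x := by
  have hf := h2.continuous_cost hu i
  have hfin : ∀ x y, Metric.hausdorffEDist (Q.Z i x) (Q.Z i y) ≠ ⊤ := fun x y =>
    Metric.hausdorffEDist_ne_top_of_nonempty_of_bounded (h2.2.1 i x).1 (h2.2.1 i y).1
      (h2.2.1 i x).2.isBounded (h2.2.1 i y).2.isBounded
  have hnear : ∀ x, ∀ ε > 0, ∀ᶠ y in 𝓝 x, Metric.hausdorffDist (Q.Z i x) (Q.Z i y) < ε :=
    fun x ε hε => Metric.eventually_nhds_iff.2 <| by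
      obtain ⟨δ, hδ, h⟩ := h2.2.2.2.2.1 i x ε hε
      exact ⟨δ, hδ, fun y hy => h y hy⟩
  refine continuous_iff_continuousAt.2 fun x => tendsto_order.2 ⟨fun a ha => ?_, fun a ha => ?_⟩
  · obtain ⟨O, W, hO, hW, hxO, hZW, hOW⟩ := generalized_tube_lemma (isCompact_singleton (x := x))
      (h2.2.1 i x).2 (isOpen_lt (continuous_const (y := a)) hf) (by
        rintro ⟨y, z⟩ ⟨rfl, hz⟩
        exact ha.trans_le (h2.Mop_le hu hz))
    obtain ⟨δ, hδ, hδW⟩ := (h2.2.1 i x).2.exists_thickening_subset_open hW hZW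
    filter_upwards [hnear x δ hδ, hO.mem_nhds (hxO rfl)] with y hy hyO
    obtain ⟨z, hz, h⟩ := h2.exists_Mop_eq hu i y
    obtain ⟨z', hz', hzz'⟩ := Metric.exists_dist_lt_of_hausdorffDist_lt' hz hy (hfin x y)
    rw [h]
    have hzW : z ∈ W := hδW (Metric.mem_thickening_iff.2 ⟨z', hz', by rwa [dist_comm]⟩)
    exact hOW (show (y, z) ∈ O ×ˢ W from ⟨hyO, hzW⟩)
  · obtain ⟨z, hz, h⟩ := h2.exists_Mop_eq hu i x
    replace ha : u i (Q.Γ i x z) + Q.K i x z < a := h ▸ ha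
    obtain ⟨δ, hδ, hlt⟩ := Metric.eventually_nhds_iff.1
      ((hf.tendsto (x, z)).eventually_lt_const ha)
    filter_upwards [hnear x δ hδ, Metric.ball_mem_nhds x hδ] with y hy hyx
    obtain ⟨z', hz', hzz'⟩ := Metric.exists_dist_lt_of_hausdorffDist_lt hz hy (hfin x y)
    refine (h2.Mop_le hu hz').trans_lt (hlt (y := (y, z')) ?_)
    rw [Prod.dist_eq]
    exact max_lt hyx (by rwa [dist_comm])

end Intervention

lemma HJBData.jetL_affine (P : HJBData d d' M 𝒜) (i : Fin M) (α : 𝒜) (x : E d) (s : Fin M → ℝ)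
    (p : E d) (A : E d →L[ℝ] E d) (t r : ℝ) :
    P.jetL i α x (fun j => t * s j - r) (t • p) (t • A) = t * P.jetL i α x s p A -
      r * (P.cz i α x - ∑ j ∈ Finset.univ.erase i, P.dcp i j α x) -
        (1 - t) * P.runCost i α x := by
  have h1 : ∑ j ∈ Finset.univ.erase i, P.dcp i j α x * (t * s j - r) =
      t * ∑ j ∈ Finset.univ.erase i, P.dcp i j α x * s j -
        r * ∑ j ∈ Finset.univ.erase i, P.dcp i j α x := by
    rw [Finset.mul_sum, Finset.mul_sum, ← Finset.sum_sub_distrib]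
    exact Finset.sum_congr rfl fun j _ => by ring
  have h2 : ∑ k, ⟪(t • A) (colVec (P.σm i α x) k), colVec (P.σm i α x) k⟫ =
      t * ∑ k, ⟪A (colVec (P.σm i α x) k), colVec (P.σm i α x) k⟫ := by
    rw [Finset.mul_sum]
    exact Finset.sum_congr rfl fun k _ => real_inner_smul_left _ _ _
  simp only [HJBData.jetL, h1, h2, real_inner_smul_right]
  ring

lemma isLocalMax_of_contract {U : E d → ℝ} {t r : ℝ} (ht : 0 < t) {x p : E d}
    {A : E d →L[ℝ] E d} (h : IsLocalMax (fun z => t * U z - r - quadTest x p A z) x) :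
    IsLocalMax (fun z => U z - quadTest x (t⁻¹ • p) (t⁻¹ • A) z) x := by
  filter_upwards [h] with z hz
  have hq : ∀ y, quadTest x p A y = t * quadTest x (t⁻¹ • p) (t⁻¹ • A) y := fun y => by
    simp only [quadTest, _root_.smul_apply, real_inner_smul_left]
    field_simp
  rw [hq, hq] at hz
  refine le_of_mul_le_mul_left ?_ ht
  linarith

/-- Contracting a subsolution towards a large negative constant keeps the linear inequalities. -/
lemma H1.jetNonpos_contract {P : HJBData d d' M 𝒜} {C lam0 : ℝ} (h1 : H1 P C lam0)
    {s : Fin M → ℝ} {θ B : ℝ} (hθ0 : 0 ≤ θ) (hθ1 : θ < 1) (hB : C ≤ lam0 * B) (hB0 : 0 ≤ B)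
    {i : Fin M} {x p : E d} {A : E d →L[ℝ] E d}
    (h : P.JetNonpos i x s ((1 - θ)⁻¹ • p) ((1 - θ)⁻¹ • A)) :
    P.JetNonpos i x (fun j => (1 - θ) * s j - θ * B) p A := fun α hα => by
  have ht : 0 < 1 - θ := by linarith
  have h3 := P.jetL_affine i α x s ((1 - θ)⁻¹ • p) ((1 - θ)⁻¹ • A) (1 - θ) (θ * B)
  rw [smul_inv_smul₀ ht.ne', smul_inv_smul₀ ht.ne'] at h3
  obtain ⟨-, -, -, -, -, -, -, -, -, -, -, hl, -, -, -, hlam⟩ := h1.2.2 i α hα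
  rw [h3]
  have h4 := mul_le_mul_of_nonneg_left (hlam x) (mul_nonneg hθ0 hB0)
  have h5 := mul_le_mul_of_nonneg_left ((neg_le_abs _).trans (hl x)) hθ0
  have h6 := mul_le_mul_of_nonneg_left hB hθ0
  have h7 := mul_nonpos_of_nonneg_of_nonpos ht.le (h α hα)
  linarith

/-- Geometric convergence of the iterated optimal stopping
approximation: under (H.1)–(H.4), `0 ≤ u^n − u ≤ C (1−μ)^n`. -/
theorem iterated_optimal_stopping_convergence
    {d d' M : ℕ} {𝒜 𝒵 : Type} [MetricSpace 𝒜] [MetricSpace 𝒵]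
    (P : HJBData d d' M 𝒜) (Q : ImpulseData d M 𝒵) (C lam0 κ₀ C4 : ℝ)
    (h1 : H1 P C lam0) (h2 : H2 Q κ₀) (h3 : H3 P lam0) (h4 : H4 Q C4)
    (u : Fin M → E d → ℝ) (hu : Bdd u ∧ IsSolution (Fqvi P Q) u)
    (un : ℕ → Fin M → E d → ℝ)
    (h0 : Bdd (un 0) ∧ IsSolution (Fhjb P) (un 0))
    (hstep : ∀ n : ℕ, Bdd (un (n + 1)) ∧
      IsSolution (Fob P (fun i x => Q.Mop i (un n) x)) (un (n + 1))) :
    ∃ μ Cc : ℝ, 0 < μ ∧ μ ≤ 1 ∧ 0 ≤ Cc ∧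
      ∀ (n : ℕ) (i : Fin M) (x : E d),
        0 ≤ un n i x - u i x ∧ un n i x - u i x ≤ Cc * (1 - μ) ^ n := by
  have hM := h2.continuous_Mop hu.2.1
  have huB := hu.1
  have huS : IsSolution (Fob P fun i x => Q.Mop i u x) u := hu.2
  have hunB : ∀ n, Bdd (un n) := fun n => by
    cases n with
    | zero => exact h0.1
    | succ n => exact (hstep n).1
  have hunC : ∀ n i, Continuous (un n i) := fun n => by
    cases n with
    | zero => exact h0.2.1
    | succ n => exact (hstep n).2.1
  have hlower : ∀ n i x, u i x ≤ un n i x := fun n => by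
    induction n with
    | zero =>
      exact h1.le_of_jets_of_bdd huS.1 (hunC 0) hM huB (hunB 0) (huS.2.1.jets_obstacle h1)
        fun i x p A h => Or.inl (h0.2.2.2.jets_hjb h1 i x p A h)
    | succ n ih =>
      exact h1.le_of_jets_of_bdd huS.1 (hunC _) hM huB (hunB _) (huS.2.1.jets_obstacle h1)
        fun i x p A h => ((hstep n).2.2.2.jets_obstacle h1 i x p A h).imp_right
          (h2.Mop_mono huS.1 (hunC n) ih i x).trans
  have hupper : ∀ n i x, un n i x ≤ un 0 i x := fun n => by
    cases n with
    | zero => exact fun _ _ => le_rfl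
    | succ n =>
      obtain ⟨B, hB⟩ := hunB (n + 1)
      exact h1.le_of_jets_of_bdd (Ψ := fun _ _ => B) (hunC _) (hunC 0) (fun _ => continuous_const)
        (hunB _) (hunB 0) (fun i x p A h => ⟨((hstep n).2.2.1.jets_obstacle h1 i x p A h).1,
          (le_abs_self _).trans (hB i x)⟩)
        fun i x p A h => Or.inl (h0.2.2.2.jets_hjb h1 i x p A h)
  obtain ⟨B, hB0, hBu, hB, hBC⟩ : ∃ B, 0 < B ∧ (∀ i x, -B ≤ u i x) ∧
      (∀ n i x, un n i x ≤ B) ∧ C ≤ lam0 * B := by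
    obtain ⟨B₁, hB₁⟩ := huB
    obtain ⟨B₂, hB₂⟩ := hunB 0
    have hlam := h1.1
    refine ⟨|B₁| + |B₂| + |C| / lam0 + 1, by positivity, fun i x => ?_, fun n i x => ?_, ?_⟩
    · have : 0 ≤ |C| / lam0 := by positivity
      linarith [(abs_le.1 (hB₁ i x)).1, le_abs_self B₁, abs_nonneg B₂]
    · have : 0 ≤ |C| / lam0 := by positivity
      linarith [hupper n i x, (abs_le.1 (hB₂ i x)).2, le_abs_self B₂, abs_nonneg B₁]
    · have h : lam0 * (|C| / lam0) = |C| := mul_div_cancel₀ _ hlam.ne'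
      have : 0 ≤ lam0 * (|B₁| + |B₂| + 1) := by positivity
      linarith [le_abs_self C]
  have hκ := h2.1
  obtain ⟨μ, hμ0, hμ1, hμ⟩ : ∃ μ : ℝ, 0 < μ ∧ μ ≤ 1 ∧ μ * (2 * B) ≤ κ₀ := by
    refine ⟨min 1 (κ₀ / (2 * B)), by positivity, min_le_left _ _, ?_⟩
    rw [← le_div_iff₀ (by positivity)]
    exact min_le_right _ _
  have hgeom : ∀ n i x, (1 - (1 - μ) ^ n) * un n i x - (1 - μ) ^ n * B ≤ u i x := fun n => by
    induction n with
    | zero => simpa using hBu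
    | succ n ih =>
      set θ := (1 - μ) ^ n with hθ
      have hθ0 : 0 ≤ θ := pow_nonneg (by linarith) n
      have hθ1 : θ ≤ 1 := pow_le_one₀ (by linarith) (by linarith)
      rw [pow_succ, ← hθ]
      have hθ' : 0 ≤ θ * (1 - μ) := mul_nonneg hθ0 (by linarith)
      have hθ1' : θ * (1 - μ) < 1 := by nlinarith
      refine h1.le_of_jets_of_bdd
        (U := fun i x => (1 - θ * (1 - μ)) * un (n + 1) i x - θ * (1 - μ) * B)
        (fun i => (continuous_const.mul (hunC _ i)).sub continuous_const) huS.1 hM ?_ huB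
        (fun i x p A h => ?_)
        (huS.2.2.jets_obstacle h1)
      · obtain ⟨B', hB'⟩ := hunB (n + 1)
        refine ⟨(1 - θ * (1 - μ)) * B' + θ * (1 - μ) * B, fun i x => (abs_sub _ _).trans ?_⟩
        rw [abs_mul, abs_of_pos (sub_pos.2 hθ1'), abs_of_nonneg (mul_nonneg hθ' hB0.le)]
        have := mul_le_mul_of_nonneg_left (hB' i x) (sub_pos.2 hθ1').le
        linarith
      · obtain ⟨hjet, hobs⟩ := (hstep n).2.2.1.jets_obstacle h1 i x _ _
          (isLocalMax_of_contract (sub_pos.2 hθ1') h)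
        refine ⟨h1.jetNonpos_contract hθ' hθ1' hBC hB0.le hjet, ?_⟩
        obtain ⟨z, hz, hMz⟩ := h2.exists_Mop_eq huS.1 i x
        rw [hMz]
        have e1 := mul_le_mul_of_nonneg_left (hobs.trans (h2.Mop_le (hunC n) hz))
          (sub_nonneg.2 hθ1)
        have e2 := mul_le_mul_of_nonneg_left (h2.2.2.2.2.2 i x z hz) hθ0
        have e3 := mul_le_mul_of_nonneg_left hμ hθ0
        have e4 := mul_le_mul_of_nonneg_left (hB (n + 1) i x) (mul_nonneg hθ0 hμ0.le)
        linarith [ih i (Q.Γ i x z)]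
  refine ⟨μ, 2 * B, hμ0, hμ1, by positivity, fun n i x => ⟨sub_nonneg.2 (hlower n i x), ?_⟩⟩
  have hθ0 : 0 ≤ (1 - μ) ^ n := pow_nonneg (by linarith) n
  nlinarith [hgeom n i x, mul_le_mul_of_nonneg_left (hB n i x) hθ0]
end HJBQVI
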